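/- arXiv:2310.00846 — 2 statements merged into one kernel-verified Lean document; each statement's English description precedes it below -/
import Mathlib

section
/- Let G be a simple graph on n vertices with adjacency matrix A (a symmetric 0-1 matrix with zero diagonal) and walk matrix W = [e, Ae, A²e, …, A^{n−1}e]. Suppose 2^{⌊n/2⌋} divides det(W) and the integer det(W)/2^{⌊n/2⌋} is odd and square-free. Then G is determined by its generalized spectrum: for every simple graph H on n vertices whose adjacency matrix B satisfies det(xI−B)=det(xI−A) and det(xI−(J−I−B))=det(xI−(J−I−A)), there exists a permutation matrix P with PᵀAP = B. -/
open Matrix Polynomial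

/-- The walk matrix `[e, Ae, A²e, …, A^{n−1}e]` of an `n × n` matrix `A`,
whose `j`-th column is `A^j *ᵥ e`, where `e` is the all-ones vector. -/
def walkMatrix {n : ℕ} (A : Matrix (Fin n) (Fin n) ℤ) : Matrix (Fin n) (Fin n) ℤ :=
  Matrix.of fun i j => ((A ^ (j : ℕ)) *ᵥ fun _ => (1 : ℤ)) i

/-- A symmetric 0-1 matrix with zero diagonal (adjacency matrix of a simple graph). -/
def IsAdjacencyMatrix {n : ℕ} (A : Matrix (Fin n) (Fin n) ℤ) : Prop :=
  A.IsSymm ∧ (∀ i, A i i = 0) ∧ ∀ i j, A i j = 0 ∨ A i j = 1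

section

variable {n : ℕ}

/-- The vector `r(A)e`, where `e` is the all-ones vector. -/
noncomputable def polyVec (A : Matrix (Fin n) (Fin n) ℤ) (r : ℤ[X]) : Fin n → ℤ :=
  aeval A r *ᵥ fun _ => (1 : ℤ)

/-- The moment functional `r ↦ eᵀ r(A) e`. -/
noncomputable def moment (A : Matrix (Fin n) (Fin n) ℤ) (r : ℤ[X]) : ℤ :=
  ∑ i, polyVec A r i

section polyVec

variable (A : Matrix (Fin n) (Fin n) ℤ)

lemma polyVec_add (r s : ℤ[X]) : polyVec A (r + s) = polyVec A r + polyVec A s := by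
  simp [polyVec, Matrix.add_mulVec]

lemma polyVec_sub (r s : ℤ[X]) : polyVec A (r - s) = polyVec A r - polyVec A s := by
  simp [polyVec, Matrix.sub_mulVec]

lemma polyVec_mul (r s : ℤ[X]) : polyVec A (r * s) = aeval A r *ᵥ polyVec A s := by
  simp [polyVec, Matrix.mulVec_mulVec]

lemma polyVec_C_mul (c : ℤ) (r : ℤ[X]) : polyVec A (C c * r) = c • polyVec A r := by
  rw [polyVec, ← Polynomial.smul_eq_C_mul, map_smul, Matrix.smul_mulVec, polyVec]

lemma polyVec_sum {ι : Type*} (s : Finset ι) (f : ι → ℤ[X]) :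
    polyVec A (∑ i ∈ s, f i) = ∑ i ∈ s, polyVec A (f i) := by
  simp only [polyVec, map_sum, Matrix.sum_mulVec]

lemma polyVec_charpoly_mul (r : ℤ[X]) : polyVec A (r * A.charpoly) = 0 := by
  simp [polyVec, Matrix.aeval_self_charpoly]

lemma moment_add (r s : ℤ[X]) : moment A (r + s) = moment A r + moment A s := by
  simp [moment, polyVec_add, Finset.sum_add_distrib]

lemma moment_sub (r s : ℤ[X]) : moment A (r - s) = moment A r - moment A s := by
  simp [moment, polyVec_sub, Finset.sum_sub_distrib]

lemma moment_C_mul (c : ℤ) (r : ℤ[X]) : moment A (C c * r) = c * moment A r := by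
  rw [moment, moment, polyVec_C_mul, Finset.mul_sum]
  rfl

lemma moment_mul_charpoly (r : ℤ[X]) : moment A (r * A.charpoly) = 0 := by
  simp [moment, polyVec_charpoly_mul]

variable {A}

lemma polyVec_dotProduct (hA : A.IsSymm) (r s : ℤ[X]) :
    polyVec A r ⬝ᵥ polyVec A s = moment A (r * s) := by
  have h : (aeval A r)ᵀ = aeval A r := by
    rw [Polynomial.aeval_eq_sum_range, Matrix.transpose_sum]
    simp only [Matrix.transpose_smul, Matrix.transpose_pow, hA.eq]
  rw [moment, polyVec_mul, polyVec, ← Matrix.vecMul_transpose, h, ← Matrix.dotProduct_mulVec]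
  simp [dotProduct]

lemma walkMatrix_apply (i j : Fin n) : walkMatrix A i j = polyVec A (X ^ (j : ℕ)) i := by
  simp [walkMatrix, polyVec]

lemma polyVec_eq_walkMatrix_mulVec {r : ℤ[X]} (hr : r.degree < n) :
    polyVec A r = walkMatrix A *ᵥ fun j => r.coeff j := by
  have h : r = ∑ j : Fin n, C (r.coeff j) * X ^ (j : ℕ) := by
    rw [Fin.sum_univ_eq_sum_range (fun j => C (r.coeff j) * X ^ j)]
    conv_lhs => rw [r.as_sum_range_C_mul_X_pow' (show r.natDegree < n + 1 by
      have := natDegree_le_of_degree_le hr.le; omega)]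
    rw [Finset.sum_range_succ, coeff_eq_zero_of_degree_lt hr]
    simp
  ext i
  conv_lhs => rw [h]
  simp only [polyVec_sum, polyVec_C_mul, Finset.sum_apply, Matrix.mulVec, dotProduct,
    walkMatrix_apply, Pi.smul_apply, smul_eq_mul]
  exact Finset.sum_congr rfl fun _ _ => mul_comm _ _

lemma walkMatrix_transpose_mul_self (hA : A.IsSymm) (i j : Fin n) :
    ((walkMatrix A)ᵀ * walkMatrix A) i j = moment A (X ^ ((i : ℕ) + j)) := by
  rw [pow_add, ← polyVec_dotProduct hA]
  simp [Matrix.mul_apply, dotProduct, walkMatrix_apply]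

lemma walkMatrix_gram_mulVec (hA : A.IsSymm) {r : ℤ[X]} (hr : r.degree < n) (k : Fin n) :
    (((walkMatrix A)ᵀ * walkMatrix A) *ᵥ fun j => r.coeff j) k = moment A (X ^ (k : ℕ) * r) := by
  rw [← Matrix.mulVec_mulVec, ← polyVec_eq_walkMatrix_mulVec hr, ← polyVec_dotProduct hA]
  simp [Matrix.mulVec, dotProduct, walkMatrix_apply]

lemma moment_congr {B : Matrix (Fin n) (Fin n) ℤ}
    (h : ∀ k, moment A (X ^ k) = moment B (X ^ k)) (r : ℤ[X]) : moment A r = moment B r := by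
  induction r using Polynomial.induction_on' with
  | add p q hp hq => rw [moment_add, moment_add, hp, hq]
  | monomial k c => rw [← C_mul_X_pow_eq_monomial, moment_C_mul, moment_C_mul, h]

lemma even_moment_X_pow (hA : IsAdjacencyMatrix A) {k : ℕ} (hk : k ≠ 0) :
    (2 : ℤ) ∣ moment A (X ^ k) := by
  have hsq : ∀ a : ℤ, (2 : ℤ) ∣ a * a - a := fun a => by
    have := Int.even_mul_pred_self a
    rw [mul_sub, mul_one] at this
    exact this.two_dvd
  have hquad : ∀ y : Fin n → ℤ, (2 : ℤ) ∣ y ⬝ᵥ (A *ᵥ y) := by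
    intro y
    have : y ⬝ᵥ (A *ᵥ y) = ∑ x : Fin n × Fin n, y x.1 * A x.1 x.2 * y x.2 := by
      simp [dotProduct, Matrix.mulVec, Fintype.sum_prod_type, Finset.mul_sum, mul_assoc]
    rw [this, ← Nat.cast_ofNat (R := ℤ) (n := 2), ← ZMod.intCast_zmod_eq_zero_iff_dvd]
    push_cast
    refine Finset.sum_involution (fun x _ => x.swap) ?_ ?_ ?_ ?_
    · rintro ⟨i, j⟩ -
      have : A j i = A i j := hA.1.apply i j
      simp only [Prod.swap, this]
      have h2 : (2 : ZMod 2) = 0 := rfl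
      linear_combination (y i * A i j * y j : ZMod 2) * h2
    · rintro ⟨i, j⟩ - h1 h2
      simp only [Prod.swap, Prod.mk.injEq] at h2
      apply h1
      simp [h2.1, hA.2.1]
    · simp
    · simp
  induction k using Nat.strong_induction_on with
  | _ k ih =>
    rcases Nat.even_or_odd' k with ⟨j, rfl | rfl⟩
    · have h1 := ih j (by omega) (by omega)
      rw [two_mul, pow_add, ← polyVec_dotProduct hA.1]
      have : polyVec A (X ^ j) ⬝ᵥ polyVec A (X ^ j)
          = ∑ i, (polyVec A (X ^ j) i * polyVec A (X ^ j) i - polyVec A (X ^ j) i)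
            + moment A (X ^ j) := by
        simp [moment, dotProduct]
      rw [this]
      exact dvd_add (Finset.dvd_sum fun i _ => hsq _) h1
    · rw [show (X : ℤ[X]) ^ (2 * j + 1) = X ^ j * (X * X ^ j) by ring, ← polyVec_dotProduct hA.1,
        polyVec_mul _ X]
      simpa using hquad (polyVec A (X ^ j))

end polyVec

section GeneralizedSpectrum

/-- A rank-one perturbation formula for determinants of matrices over a domain. -/
lemma det_add_vecMulVec_of_ne_zero {m R : Type*} [Fintype m] [DecidableEq m] [CommRing R]
    [IsDomain R] (M : Matrix m m R) (hM : M.det ≠ 0) (u v : m → R) :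
    (M + Matrix.vecMulVec u v).det = M.det + v ⬝ᵥ (M.adjugate *ᵥ u) := by
  let K := FractionRing R
  let φ : R →+* K := algebraMap R K
  have hφ : Function.Injective φ := IsFractionRing.injective R K
  have hdet : (φ.mapMatrix M).det ≠ 0 := by
    rw [← RingHom.map_det]
    exact (map_ne_zero_iff φ hφ).2 hM
  apply hφ
  have h1 : φ.mapMatrix (M + Matrix.vecMulVec u v) = φ.mapMatrix M
      + Matrix.replicateCol Unit (φ ∘ u) * Matrix.replicateRow Unit (φ ∘ v) := by
    ext i j
    simp [Matrix.mul_apply, Matrix.vecMulVec_apply]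
  have h3 := Matrix.det_add_replicateCol_mul_replicateRow (ι := Unit) (A := φ.mapMatrix M)
    (isUnit_iff_ne_zero.2 hdet) (φ ∘ u) (φ ∘ v)
  rw [RingHom.map_det, h1, h3, Matrix.det_unique (n := Unit), Matrix.inv_def, Ring.inverse_eq_inv',
    map_add, RingHom.map_det]
  have h2 : (1 + Matrix.replicateRow Unit (φ ∘ v)
      * ((φ.mapMatrix M).det⁻¹ • (φ.mapMatrix M).adjugate)
      * Matrix.replicateCol Unit (φ ∘ u) : Matrix Unit Unit K) default default
      = 1 + (φ.mapMatrix M).det⁻¹ * ((φ ∘ v) ⬝ᵥ ((φ.mapMatrix M).adjugate *ᵥ (φ ∘ u))) := by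
    rw [Matrix.mul_smul, Matrix.smul_mul, Matrix.mul_assoc]
    simp [Matrix.mul_apply, dotProduct, Matrix.mulVec]
  rw [h2, mul_add, mul_one, mul_inv_cancel_left₀ hdet]
  congr 1
  rw [← RingHom.map_adjugate]
  simp [dotProduct, Matrix.mulVec, map_sum]

variable (A B : Matrix (Fin n) (Fin n) ℤ)

lemma charpoly_complement_comp :
    (((Matrix.of fun _ _ => (1 : ℤ)) - 1 - A).charpoly).comp (-(X + 1))
      = (-1) ^ n * (A.charpoly + ∑ i, ∑ j, A.charmatrix.adjugate i j) := by
  have h1 : ((((Matrix.of fun _ _ => (1 : ℤ)) - 1 - A).charmatrix).map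
      (Polynomial.compRingHom (-(X + 1)))) = -(A.charmatrix + Matrix.vecMulVec 1 1) := by
    ext1 i j
    rcases eq_or_ne i j with rfl | hij
    · simp
      ring
    · simp [hij]
      ring
  have h2 := det_add_vecMulVec_of_ne_zero A.charmatrix A.charpoly_monic.ne_zero 1 1
  rw [Matrix.charpoly, ← Polynomial.coe_compRingHom_apply, RingHom.map_det,
    RingHom.mapMatrix_apply, h1, Matrix.det_neg, h2, Fintype.card_fin]
  simp [Matrix.charpoly, dotProduct, Matrix.mulVec]

variable {A B}

lemma sum_adjugate_charmatrix_congr (h1 : B.charpoly = A.charpoly)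
    (h2 : ((Matrix.of fun _ _ => (1 : ℤ)) - 1 - B).charpoly
        = ((Matrix.of fun _ _ => (1 : ℤ)) - 1 - A).charpoly) :
    ∑ i, ∑ j, B.charmatrix.adjugate i j = ∑ i, ∑ j, A.charmatrix.adjugate i j := by
  have hA := charpoly_complement_comp A
  have hB := charpoly_complement_comp B
  rw [h2, hA, h1] at hB
  have := mul_left_cancel₀ (pow_ne_zero n (neg_ne_zero.2 one_ne_zero)) hB
  exact (add_left_cancel this).symm

/-- The coefficients of `adj(X - A)`, viewed as a polynomial with matrix coefficients. -/
noncomputable def adjCoeff (A : Matrix (Fin n) (Fin n) ℤ) (i : ℕ) : Matrix (Fin n) (Fin n) ℤ :=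
  (matPolyEquiv A.charmatrix.adjugate).coeff i

lemma matPolyEquiv_adjugate_mul :
    matPolyEquiv A.charmatrix.adjugate * (X - C A) = A.charpoly.map (algebraMap ℤ _) := by
  rw [← Matrix.matPolyEquiv_charmatrix, ← map_mul, Matrix.adjugate_mul, ← Matrix.charpoly]
  exact matPolyEquiv_smul_one _

lemma adjCoeff_zero_mul : -(adjCoeff A 0 * A) = A.charpoly.coeff 0 • 1 := by
  have := congrArg (fun q => q.coeff 0) (matPolyEquiv_adjugate_mul (A := A))
  simpa [mul_sub, adjCoeff, Algebra.algebraMap_eq_smul_one] using this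

lemma adjCoeff_succ (i : ℕ) :
    adjCoeff A i - adjCoeff A (i + 1) * A = A.charpoly.coeff (i + 1) • 1 := by
  have := congrArg (fun q => q.coeff (i + 1)) (matPolyEquiv_adjugate_mul (A := A))
  simpa [mul_sub, adjCoeff, Algebra.algebraMap_eq_smul_one] using this

lemma adjCoeff_eq_zero {i : ℕ} (hi : n ≤ i) : adjCoeff A i = 0 := by
  rcases Nat.eq_zero_or_pos n with rfl | hn
  · exact Subsingleton.elim _ _
  have : NeZero n := ⟨hn.ne'⟩
  apply coeff_eq_zero_of_natDegree_lt
  set P := matPolyEquiv A.charmatrix.adjugate with hP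
  rcases eq_or_ne P 0 with h0 | h0
  · rw [h0]; simpa using by omega
  have h1 := (monic_X_sub_C A).natDegree_mul' h0
  have h2 : (P * (X - C A)).natDegree = n := by
    rw [hP, matPolyEquiv_adjugate_mul, A.charpoly_monic.natDegree_map,
      Matrix.charpoly_natDegree_eq_dim, Fintype.card_fin]
  rw [(monic_X_sub_C A).natDegree_mul_comm, h2, natDegree_X_sub_C] at h1
  omega

lemma sum_adjCoeff (i : ℕ) :
    ∑ k, ∑ l, adjCoeff A i k l = (∑ k, ∑ l, A.charmatrix.adjugate k l).coeff i := by
  simp [adjCoeff, matPolyEquiv_coeff_apply]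

lemma moment_X_pow (k : ℕ) : moment A (X ^ k) = ∑ i, ∑ j, (A ^ k) i j := by
  simp [moment, polyVec, Matrix.mulVec, dotProduct]

/-- Graphs with the same generalized spectrum have the same numbers of walks of every length. -/
lemma moment_X_pow_congr (h1 : B.charpoly = A.charpoly)
    (h2 : ((Matrix.of fun _ _ => (1 : ℤ)) - 1 - B).charpoly
        = ((Matrix.of fun _ _ => (1 : ℤ)) - 1 - A).charpoly) (k : ℕ) :
    moment A (X ^ k) = moment B (X ^ k) := by
  let s (M : Matrix (Fin n) (Fin n) ℤ) : ℤ := ∑ i, ∑ j, M i j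
  have s_sub (M N : Matrix (Fin n) (Fin n) ℤ) : s (M - N) = s M - s N := by
    simp [s, Finset.sum_sub_distrib]
  have s_neg (M : Matrix (Fin n) (Fin n) ℤ) : s (-M) = -s M := by
    simp [s]
  have s_smul (c : ℤ) (M : Matrix (Fin n) (Fin n) ℤ) : s (c • M) = c * s M := by
    simp [s, Finset.mul_sum, Matrix.smul_apply, -zsmul_eq_mul]
  have rec_zero (M : Matrix (Fin n) (Fin n) ℤ) (k : ℕ) :
      s (adjCoeff M 0 * M ^ (k + 1)) = -(M.charpoly.coeff 0 * s (M ^ k)) := by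
    have := congrArg (fun N => s (N * M ^ k)) (adjCoeff_zero_mul (A := M))
    simp only [neg_mul, mul_assoc, ← pow_succ', smul_mul_assoc, one_mul, s_neg, s_smul] at this
    linarith
  have rec_succ (M : Matrix (Fin n) (Fin n) ℤ) (i k : ℕ) :
      s (adjCoeff M (i + 1) * M ^ (k + 1))
        = s (adjCoeff M i * M ^ k) - M.charpoly.coeff (i + 1) * s (M ^ k) := by
    have := congrArg (fun N => s (N * M ^ k)) (adjCoeff_succ (A := M) i)
    simp only [sub_mul, mul_assoc, ← pow_succ', smul_mul_assoc, one_mul, s_sub, s_smul] at this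
    linarith
  rcases Nat.eq_zero_or_pos n with rfl | hn
  · rw [Subsingleton.elim A B]
  obtain ⟨m, rfl⟩ : ∃ m, n = m + 1 := ⟨n - 1, by omega⟩
  have top (M : Matrix (Fin (m + 1)) (Fin (m + 1)) ℤ) (k : ℕ) :
      s (M ^ k) = s (adjCoeff M m * M ^ k) := by
    have h := rec_succ M m k
    have hc : M.charpoly.coeff (m + 1) = 1 := by
      have := M.charpoly_monic.coeff_natDegree
      rwa [Matrix.charpoly_natDegree_eq_dim, Fintype.card_fin] at this
    rw [adjCoeff_eq_zero le_rfl, hc] at h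
    simp only [zero_mul, one_mul] at h
    have h0 : s 0 = 0 := by simp [s]
    linarith
  have key : ∀ k i, s (adjCoeff A i * A ^ k) = s (adjCoeff B i * B ^ k) := by
    intro k
    induction k with
    | zero =>
      intro i
      simp only [pow_zero, mul_one, s]
      rw [sum_adjCoeff, sum_adjCoeff, sum_adjugate_charmatrix_congr h1 h2]
    | succ k ih =>
      intro i
      cases i with
      | zero => rw [rec_zero, rec_zero, top, top, ih, h1]
      | succ i => rw [rec_succ, rec_succ, top, top, ih, ih, h1]
  rw [moment_X_pow, moment_X_pow]
  change s _ = s _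
  rw [top, top, key]

end GeneralizedSpectrum

section LocalBasis

/-- Monic polynomials `1, X, …, X^(d-1), g, X g, X² g, …`. -/
noncomputable def shiftedBasis (d : ℕ) (g : ℤ[X]) (j : ℕ) : ℤ[X] :=
  if j < d then X ^ j else X ^ (j - d) * g

/-- The matrix with columns `A^j e` for `j < d` and `A^(j-d) g(A) e / p` for `d ≤ j`. -/
noncomputable def localBasis (A : Matrix (Fin n) (Fin n) ℤ) (p : ℤ) (d : ℕ) (g : ℤ[X]) :
    Matrix (Fin n) (Fin n) ℤ :=
  Matrix.of fun i j => if (j : ℕ) < d then polyVec A (X ^ (j : ℕ)) i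
    else polyVec A (X ^ ((j : ℕ) - d) * g) i / p

variable {A B : Matrix (Fin n) (Fin n) ℤ} {p : ℤ} {d : ℕ} {g : ℤ[X]}

lemma shiftedBasis_monic (hg : g.Monic) (j : ℕ) : (shiftedBasis d g j).Monic := by
  unfold shiftedBasis
  split_ifs
  · exact monic_X_pow j
  · exact (monic_X_pow _).mul hg

lemma shiftedBasis_natDegree (hg : g.Monic) (hd : g.natDegree = d) (j : ℕ) :
    (shiftedBasis d g j).natDegree = j := by
  unfold shiftedBasis
  split_ifs with h
  · exact natDegree_X_pow j
  · rw [(monic_X_pow _).natDegree_mul hg, natDegree_X_pow, hd]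
    omega

/-- The change of basis matrix from the monomials to `shiftedBasis`. -/
noncomputable def shiftedBasisMatrix (n d : ℕ) (g : ℤ[X]) : Matrix (Fin n) (Fin n) ℤ :=
  Matrix.of fun i j => (shiftedBasis d g j).coeff i

lemma det_shiftedBasisMatrix (hg : g.Monic) (hd : g.natDegree = d) :
    (shiftedBasisMatrix n d g).det = 1 :=
  Matrix.det_matrixOfPolynomials (fun j : Fin n => shiftedBasis d g j)
    (fun j => shiftedBasis_natDegree hg hd j) fun j => shiftedBasis_monic hg j

lemma dvd_polyVec_mul (h : ∀ i, p ∣ polyVec A g i) (r : ℤ[X]) (i : Fin n) :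
    p ∣ polyVec A (r * g) i := by
  simp only [polyVec_mul, Matrix.mulVec, dotProduct]
  exact Finset.dvd_sum fun j _ => (h j).mul_left _

lemma localBasis_mul_diagonal (hg : g.Monic) (hd : g.natDegree = d)
    (h : ∀ i, p ∣ polyVec A g i) :
    localBasis A p d g * Matrix.diagonal (fun j : Fin n => if (j : ℕ) < d then 1 else p)
      = walkMatrix A * shiftedBasisMatrix n d g := by
  ext i j
  have h1 : (walkMatrix A * shiftedBasisMatrix n d g) i j = polyVec A (shiftedBasis d g j) i := by
    rw [polyVec_eq_walkMatrix_mulVec]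
    · rfl
    · rw [degree_eq_natDegree (shiftedBasis_monic hg _).ne_zero, shiftedBasis_natDegree hg hd]
      exact_mod_cast j.2
  rw [h1, Matrix.mul_diagonal, localBasis, shiftedBasis, Matrix.of_apply]
  split_ifs
  · simp
  · exact Int.ediv_mul_cancel (dvd_polyVec_mul h _ i)

lemma det_walkMatrix_eq (hg : g.Monic) (hd : g.natDegree = d) (h : ∀ i, p ∣ polyVec A g i)
    (hn : d ≤ n) : (walkMatrix A).det = (localBasis A p d g).det * p ^ (n - d) := by
  have := congrArg Matrix.det (localBasis_mul_diagonal hg hd h)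
  rw [Matrix.det_mul, Matrix.det_mul, det_shiftedBasisMatrix hg hd, mul_one,
    Matrix.det_diagonal] at this
  rw [← this, Fin.prod_univ_eq_prod_range (fun j => if j < d then (1 : ℤ) else p)]
  congr 1
  obtain ⟨k, rfl⟩ := Nat.exists_eq_add_of_le hn
  rw [Finset.prod_range_add, Finset.prod_congr rfl (g := fun _ => (1 : ℤ))]
  · simp
  · intro x hx
    rw [if_pos (Finset.mem_range.1 hx)]

/-- If `g(A)e` and `g(B)e` both vanish modulo `p`, then the transition matrix between the two walk
matrices has denominator dividing the determinant of `localBasis B p d g`. -/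
lemma exists_mul_walkMatrix_eq_smul (hg : g.Monic) (hd : g.natDegree = d)
    (hA : ∀ i, p ∣ polyVec A g i) (hB : ∀ i, p ∣ polyVec B g i) :
    ∃ Y : Matrix (Fin n) (Fin n) ℤ,
      Y * walkMatrix B = (localBasis B p d g).det • walkMatrix A := by
  refine ⟨localBasis A p d g * (localBasis B p d g).adjugate, ?_⟩
  have hT : shiftedBasisMatrix n d g * (shiftedBasisMatrix n d g).adjugate = 1 := by
    rw [Matrix.mul_adjugate, det_shiftedBasisMatrix hg hd, one_smul]
  have key : localBasis A p d g * (localBasis B p d g).adjugate * walkMatrix B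
      * shiftedBasisMatrix n d g
      = ((localBasis B p d g).det • walkMatrix A) * shiftedBasisMatrix n d g := by
    rw [Matrix.mul_assoc _ (walkMatrix B), ← localBasis_mul_diagonal hg hd hB, Matrix.smul_mul,
      ← localBasis_mul_diagonal hg hd hA, Matrix.mul_assoc (localBasis A p d g),
      ← Matrix.mul_assoc (localBasis B p d g).adjugate, Matrix.adjugate_mul, Matrix.smul_mul,
      Matrix.one_mul, Matrix.mul_smul]
  have := congrArg (· * (shiftedBasisMatrix n d g).adjugate) key
  simpa only [Matrix.mul_assoc, hT, Matrix.mul_one] using this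

end LocalBasis

section Primes

variable {A B : Matrix (Fin n) (Fin n) ℤ} {p : ℕ}

lemma C_natCast_dvd_iff_map_eq_zero (r : ℤ[X]) :
    C (p : ℤ) ∣ r ↔ r.map (Int.castRingHom (ZMod p)) = 0 := by
  rw [C_dvd_iff_dvd_coeff, Polynomial.ext_iff]
  simp [ZMod.intCast_zmod_eq_zero_iff_dvd]

lemma dvd_polyVec_of_C_dvd {r : ℤ[X]} (h : C (p : ℤ) ∣ r) (i : Fin n) :
    (p : ℤ) ∣ polyVec A r i := by
  obtain ⟨s, rfl⟩ := h
  rw [polyVec_C_mul]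
  exact ⟨_, rfl⟩

lemma exists_monic_dvd_polyVec [Fact p.Prime] {d : ℕ} {r : ℤ[X]} (hr : r.natDegree ≤ d)
    (h0 : ¬ C (p : ℤ) ∣ r) (h : ∀ i, (p : ℤ) ∣ polyVec A r i) :
    ∃ g : ℤ[X], g.Monic ∧ g.natDegree = d ∧ ∀ i, (p : ℤ) ∣ polyVec A g i := by
  rw [C_natCast_dvd_iff_map_eq_zero] at h0
  set φ := Int.castRingHom (ZMod p) with hφ
  have hsurj : Function.Surjective φ := ZMod.intCast_surjective
  set q := r.map φ with hq
  obtain ⟨a, ha⟩ := hsurj q.leadingCoeff⁻¹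
  have hdeg : q.natDegree ≤ d := natDegree_map_le.trans hr
  have hmonic : (C q.leadingCoeff⁻¹ * q).Monic := by
    rw [mul_comm]; exact monic_mul_leadingCoeff_inv h0
  have hmon : (X ^ (d - q.natDegree) * (C q.leadingCoeff⁻¹ * q)).Monic :=
    (monic_X_pow _).mul hmonic
  obtain ⟨g, hg1, hg2, hg3⟩ := lifts_and_natDegree_eq_and_monic
    ((mem_lifts _).2 (Polynomial.map_surjective φ hsurj _)) hmon
  refine ⟨g, hg3, ?_, fun i => ?_⟩
  · rw [hg2, (monic_X_pow _).natDegree_mul hmonic, natDegree_X_pow,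
      natDegree_C_mul (inv_ne_zero (leadingCoeff_ne_zero.2 h0))]
    omega
  · have h1 : C (p : ℤ) ∣ g - X ^ (d - q.natDegree) * C a * r := by
      rw [C_natCast_dvd_iff_map_eq_zero, ← hφ]
      simp only [Polynomial.map_sub, Polynomial.map_mul, Polynomial.map_pow, map_X, map_C, hg1, ha,
        ← hq, mul_assoc, sub_self]
    rw [show g = (g - X ^ (d - q.natDegree) * C a * r) + X ^ (d - q.natDegree) * C a * r by ring,
      polyVec_add]
    exact dvd_add (dvd_polyVec_of_C_dvd h1 i) (dvd_polyVec_mul h _ i)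

lemma exists_monic_of_sum_eq_zero [Fact p.Prime] {d : ℕ} {c : Fin (d + 1) → ZMod p} (hc : c ≠ 0)
    (h : ∀ i, ∑ j, c j * (polyVec A (X ^ (j : ℕ)) i : ZMod p) = 0) :
    ∃ g : ℤ[X], g.Monic ∧ g.natDegree = d ∧ ∀ i, (p : ℤ) ∣ polyVec A g i := by
  choose b hb using fun j => ZMod.intCast_surjective (c j)
  refine exists_monic_dvd_polyVec (r := ∑ j : Fin (d + 1), C (b j) * X ^ (j : ℕ)) ?_ ?_ ?_
  · refine natDegree_sum_le_of_forall_le _ _ fun j _ => ?_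
    exact (natDegree_C_mul_X_pow_le _ _).trans (Nat.le_of_lt_succ j.2)
  · intro hdvd
    apply hc
    ext j
    rw [C_dvd_iff_dvd_coeff] at hdvd
    have := hdvd j
    simp only [finsetSum_coeff, coeff_C_mul_X_pow, Fin.val_inj] at this
    rw [Finset.sum_ite_eq, if_pos (Finset.mem_univ j)] at this
    rw [← hb, (ZMod.intCast_zmod_eq_zero_iff_dvd _ _).2 this]
    rfl
  · intro i
    rw [← ZMod.intCast_zmod_eq_zero_iff_dvd, ← h i, polyVec_sum]
    simp [polyVec_C_mul, hb, -map_intCast, -eq_intCast]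

lemma exists_monic_of_dvd_det [Fact p.Prime] (hn : n ≠ 0) (h : (p : ℤ) ∣ (walkMatrix A).det) :
    ∃ g : ℤ[X], g.Monic ∧ g.natDegree = n - 1 ∧ ∀ i, (p : ℤ) ∣ polyVec A g i := by
  obtain ⟨m, rfl⟩ := Nat.exists_eq_succ_of_ne_zero hn
  have hdet : ((walkMatrix A).map (Int.castRingHom (ZMod p))).det = 0 := by
    rw [← RingHom.mapMatrix_apply, ← RingHom.map_det]
    exact (ZMod.intCast_zmod_eq_zero_iff_dvd _ _).2 h
  obtain ⟨c, hc, hc0⟩ := Matrix.exists_mulVec_eq_zero_iff.2 hdet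
  refine exists_monic_of_sum_eq_zero hc fun i => ?_
  have := congrFun hc0 i
  simpa [Matrix.mulVec, dotProduct, walkMatrix_apply, mul_comm] using this

lemma exists_monic_two (hA : IsAdjacencyMatrix A) :
    ∃ g : ℤ[X], g.Monic ∧ g.natDegree = (n + 1) / 2 ∧ ∀ i, (2 : ℤ) ∣ polyVec A g i := by
  have : Fact (Nat.Prime 2) := ⟨Nat.prime_two⟩
  set m := (n + 1) / 2 with hm
  let v (j : ℕ) : Fin n → ZMod 2 := fun i => (polyVec A (X ^ j) i : ZMod 2)
  have horth (i j : ℕ) : v (i + 1) ⬝ᵥ v j = 0 := by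
    have h1 : v (i + 1) ⬝ᵥ v j = ((polyVec A (X ^ (i + 1)) ⬝ᵥ polyVec A (X ^ j) : ℤ) : ZMod 2) := by
      simp [v, dotProduct]
    rw [h1, polyVec_dotProduct hA.1, ← pow_add, ZMod.intCast_zmod_eq_zero_iff_dvd]
    exact even_moment_X_pow hA (by omega)
  have hdep : ¬ LinearIndependent (ZMod 2) (fun j : Fin (m + 1) => v j) := by
    intro hli
    let Y : Matrix (Fin (m + 1)) (Fin n) (ZMod 2) := Matrix.of fun j => v j
    let Z : Matrix (Fin m) (Fin n) (ZMod 2) := Matrix.of fun j => v (j + 1)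
    have hY : Y.rank = m + 1 := by
      have : Y.rank = Fintype.card (Fin (m + 1)) := LinearIndependent.rank_matrix hli
      simpa using this
    have hZ : Z.rank = m := by
      have hli' : LinearIndependent (ZMod 2) Z.row := by
        have := hli.comp (Fin.succ : Fin m → Fin (m + 1)) (Fin.succ_injective m)
        convert this using 1
        ext j i
        simp [Z]
      have : Z.rank = Fintype.card (Fin m) := LinearIndependent.rank_matrix hli'
      simpa using this
    have hmul : Z * Yᵀ = 0 := by
      ext i j
      exact horth i j
    have := Matrix.rank_add_rank_le_card_of_mul_eq_zero hmul
    rw [Matrix.rank_transpose, hY, hZ, Fintype.card_fin] at this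
    omega
  obtain ⟨c, hc, j, hj⟩ := Fintype.not_linearIndependent_iff.1 hdep
  refine exists_monic_of_sum_eq_zero (p := 2) (c := c) (fun h => hj (congrFun h j)) fun i => ?_
  simpa [v] using congrFun hc i

end Primes

section PrimeTwo

variable {A B : Matrix (Fin n) (Fin n) ℤ}

/-- The Gram matrix of the columns of the walk matrix is, up to dividing its even rows by two,
invertible modulo two. -/
lemma two_dvd_of_four_dvd_gram (hA : IsAdjacencyMatrix A) {u : ℤ} (hu : ¬ (2 : ℤ) ∣ u)
    (hdet : (walkMatrix A).det = u * 2 ^ (n / 2)) {c : Fin n → ℤ}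
    (h : ∀ k, (4 : ℤ) ∣ (((walkMatrix A)ᵀ * walkMatrix A) *ᵥ c) k) (k : Fin n) :
    (2 : ℤ) ∣ c k := by
  set H := (walkMatrix A)ᵀ * walkMatrix A with hH
  let D (i : Fin n) : ℤ := if (i : ℕ) = 0 ∧ Odd n then 1 else 2
  have hD (i : Fin n) : D i = 1 ∨ D i = 2 := by
    simp only [D]
    split_ifs <;> simp
  have hdvd (i j : Fin n) : D i ∣ H i j := by
    rw [hH, walkMatrix_transpose_mul_self hA.1]
    simp only [D]
    split_ifs with hi
    · exact one_dvd _
    · rcases eq_or_ne ((i : ℕ) + j) 0 with h0 | h0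
      · have hn : Even n := by
          rw [← Nat.not_odd_iff_even]
          exact fun ho => hi ⟨by omega, ho⟩
        have h00 : moment A (X ^ 0) = n := by simp [moment, polyVec]
        rw [h0, h00]
        exact_mod_cast hn.two_dvd
      · exact even_moment_X_pow hA h0
  choose N hN using hdvd
  have hHN : H = Matrix.diagonal D * Matrix.of N := by
    ext i j
    rw [Matrix.diagonal_mul, hN, Matrix.of_apply]
  have hprod : ∏ i, D i = 2 ^ (2 * (n / 2)) := by
    rcases Nat.even_or_odd n with hn | hn
    · have : ∀ i, D i = 2 := fun i => if_neg fun hi => (Nat.not_odd_iff_even.2 hn) hi.2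
      simp [this, Nat.two_mul_div_two_of_even hn]
    · obtain ⟨m, rfl⟩ := hn
      rw [Fin.prod_univ_succ]
      have h0 : D 0 = 1 := if_pos ⟨rfl, by simp⟩
      have hs : ∀ i : Fin (2 * m), D i.succ = 2 := fun i => if_neg (by simp)
      rw [h0, Finset.prod_congr rfl fun i _ => hs i]
      simp
      omega
  have hdetN : (Matrix.of N).det = u ^ 2 := by
    have h1 : H.det = (u * 2 ^ (n / 2)) ^ 2 := by
      rw [hH, Matrix.det_mul, Matrix.det_transpose, hdet, sq]
    rw [hHN, Matrix.det_mul, Matrix.det_diagonal, hprod] at h1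
    have h2 : (2 : ℤ) ^ (2 * (n / 2)) ≠ 0 := by positivity
    apply mul_left_cancel₀ h2
    rw [h1]
    ring
  have hNc (i : Fin n) : (2 : ℤ) ∣ (Matrix.of N *ᵥ c) i := by
    have := h i
    rw [hHN, ← Matrix.mulVec_mulVec, Matrix.mulVec_diagonal] at this
    rcases hD i with hi | hi <;> rw [hi] at this <;> omega
  have h3 : (Matrix.of N).adjugate *ᵥ (Matrix.of N *ᵥ c) = u ^ 2 • c := by
    rw [Matrix.mulVec_mulVec, Matrix.adjugate_mul, hdetN, Matrix.smul_mulVec, Matrix.one_mulVec]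
  have h4 : (2 : ℤ) ∣ u ^ 2 * c k := by
    have := congrFun h3 k
    rw [Pi.smul_apply, smul_eq_mul] at this
    rw [← this]
    simp only [Matrix.mulVec, dotProduct]
    exact Finset.dvd_sum fun j _ => (hNc j).mul_left _
  exact (Int.prime_two.dvd_or_dvd h4).resolve_left fun h5 => hu (Int.prime_two.dvd_of_dvd_pow h5)

lemma exists_common_monic_two (hA : IsAdjacencyMatrix A) (hB : IsAdjacencyMatrix B)
    (hmom : ∀ k, moment A (X ^ k) = moment B (X ^ k)) {u : ℤ} (hu : ¬ (2 : ℤ) ∣ u)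
    (hdet : (walkMatrix A).det = u * 2 ^ (n / 2)) :
    ∃ g : ℤ[X], g.Monic ∧ g.natDegree = (n + 1) / 2 ∧ (∀ i, (2 : ℤ) ∣ polyVec A g i) ∧
      ∀ i, (2 : ℤ) ∣ polyVec B g i := by
  have : Fact (Nat.Prime 2) := ⟨Nat.prime_two⟩
  obtain ⟨g, hg, hgd, hgA⟩ := exists_monic_two hA
  obtain ⟨h, hh, hhd, hhB⟩ := exists_monic_two hB
  refine ⟨g, hg, hgd, hgA, ?_⟩
  have four_dvd {M : Matrix (Fin n) (Fin n) ℤ} (hM : IsAdjacencyMatrix M) {r : ℤ[X]}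
      (hr : ∀ i, (2 : ℤ) ∣ polyVec M r i) (s : ℤ[X]) : (4 : ℤ) ∣ moment M (s * r * r) := by
    rw [← polyVec_dotProduct hM.1, dotProduct]
    exact Finset.dvd_sum fun i _ => mul_dvd_mul (dvd_polyVec_mul hr s i) (hr i)
  have hsdeg : (g - h).degree < ((n + 1) / 2 : ℕ) := by
    have h1 : g.degree = h.degree := by
      rw [degree_eq_natDegree hg.ne_zero, degree_eq_natDegree hh.ne_zero, hgd, hhd]
    have := degree_sub_lt_left h1 hg.ne_zero (by rw [hg.leadingCoeff, hh.leadingCoeff])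
    rwa [degree_eq_natDegree hg.ne_zero, hgd] at this
  have hs2deg : ((g - h) * (g - h)).degree < n := by
    rcases eq_or_ne (g - h) 0 with h0 | h0
    · rw [h0, mul_zero, degree_zero]
      exact WithBot.bot_lt_coe n
    · rw [degree_mul, degree_eq_natDegree h0] at *
      norm_cast at *
      omega
  have hs2 (k : Fin n) : (4 : ℤ) ∣ moment A (X ^ (k : ℕ) * ((g - h) * (g - h))) := by
    have e : X ^ (k : ℕ) * ((g - h) * (g - h))
        = X ^ (k : ℕ) * g * g + X ^ (k : ℕ) * h * h - C 2 * (X ^ (k : ℕ) * h * g) := by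
      rw [show (C 2 : ℤ[X]) = 2 from rfl]
      ring
    rw [e, moment_sub, moment_add, moment_C_mul]
    refine dvd_sub (dvd_add (four_dvd hA hgA _) ?_) ?_
    · rw [moment_congr hmom]
      exact four_dvd hB hhB _
    · exact mul_dvd_mul (a := (2 : ℤ)) (b := 2) dvd_rfl
        (Finset.dvd_sum fun i _ => dvd_polyVec_mul hgA _ i)
  have hs : C ((2 : ℕ) : ℤ) ∣ g - h := by
    have h1 : C ((2 : ℕ) : ℤ) ∣ (g - h) * (g - h) := by
      rw [C_dvd_iff_dvd_coeff]
      intro k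
      rcases lt_or_ge k n with hk | hk
      · exact two_dvd_of_four_dvd_gram hA hu hdet (c := fun j => ((g - h) * (g - h)).coeff j)
          (fun j => by rw [walkMatrix_gram_mulVec hA.1 hs2deg]; exact hs2 j) ⟨k, hk⟩
      · rw [coeff_eq_zero_of_degree_lt (hs2deg.trans_le (by exact_mod_cast hk))]
        exact dvd_zero _
    rw [C_natCast_dvd_iff_map_eq_zero] at h1 ⊢
    rw [Polynomial.map_mul] at h1
    exact mul_self_eq_zero.1 h1
  intro i
  rw [show g = (g - h) + h by ring, polyVec_add]
  exact dvd_add (dvd_polyVec_of_C_dvd hs i) (hhB i)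

end PrimeTwo

section SimplePrimes

variable {A B : Matrix (Fin n) (Fin n) ℤ} {p : ℕ}

lemma dvd_of_dvd_mulVec [Fact p.Prime] {M : Matrix (Fin n) (Fin n) ℤ} (hM : ¬ (p : ℤ) ∣ M.det)
    {c : Fin n → ℤ} (h : ∀ i, (p : ℤ) ∣ (M *ᵥ c) i) (k : Fin n) : (p : ℤ) ∣ c k := by
  have h3 : M.adjugate *ᵥ (M *ᵥ c) = M.det • c := by
    rw [Matrix.mulVec_mulVec, Matrix.adjugate_mul, Matrix.smul_mulVec, Matrix.one_mulVec]
  have h4 : (p : ℤ) ∣ M.det * c k := by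
    have := congrFun h3 k
    rw [Pi.smul_apply, smul_eq_mul] at this
    rw [← this]
    simp only [Matrix.mulVec, dotProduct]
    exact Finset.dvd_sum fun j _ => (h j).mul_left _
  exact ((Nat.prime_iff_prime_int.1 (Fact.out : p.Prime)).dvd_or_dvd h4).resolve_left hM

lemma C_dvd_of_dvd_polyVec [Fact p.Prime] {g : ℤ[X]} {d : ℕ}
    (hM : ¬ (p : ℤ) ∣ (localBasis A p d g).det) (hdn : d ≤ n)
    {r : ℤ[X]} (hr : r.degree < d) (h : ∀ i, (p : ℤ) ∣ polyVec A r i) : C (p : ℤ) ∣ r := by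
  have hrn : r.degree < n := hr.trans_le (by exact_mod_cast hdn)
  have e : polyVec A r = localBasis A p d g *ᵥ fun j => r.coeff j := by
    rw [polyVec_eq_walkMatrix_mulVec hrn]
    ext i
    simp only [Matrix.mulVec, dotProduct]
    refine Finset.sum_congr rfl fun j _ => ?_
    rcases lt_or_ge (j : ℕ) d with hj | hj
    · simp [localBasis, walkMatrix_apply, hj]
    · have : r.coeff j = 0 := coeff_eq_zero_of_degree_lt (hr.trans_le (by exact_mod_cast hj))
      simp [this]
  rw [e] at h
  have h2 := dvd_of_dvd_mulVec hM h
  rw [C_dvd_iff_dvd_coeff]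
  intro k
  rcases lt_or_ge k n with hk | hk
  · exact h2 ⟨k, hk⟩
  · rw [coeff_eq_zero_of_degree_lt (hrn.trans_le (by exact_mod_cast hk))]
    exact dvd_zero _

/-- Modulo `p`, the characteristic polynomial is `g` times a monic linear polynomial. -/
lemma exists_charpoly_factor [Fact p.Prime] {g : ℤ[X]} (hg : g.Monic) (hgd : g.natDegree = n - 1)
    (hn : n ≠ 0) (hgA : ∀ i, (p : ℤ) ∣ polyVec A g i)
    (hM : ¬ (p : ℤ) ∣ (localBasis A p (n - 1) g).det) :
    ∃ (a : ℤ) (t : ℤ[X]), (X + C a) * g = A.charpoly - C (p : ℤ) * t := by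
  have hρdeg : (A.charpoly %ₘ g).degree < (n - 1 : ℕ) := by
    have := degree_modByMonic_lt A.charpoly hg
    rwa [degree_eq_natDegree hg.ne_zero, hgd] at this
  have hsplit := modByMonic_add_div A.charpoly g
  have hρ : C (p : ℤ) ∣ A.charpoly %ₘ g := by
    refine C_dvd_of_dvd_polyVec hM (Nat.sub_le n 1) hρdeg fun i => ?_
    have e : A.charpoly %ₘ g = 1 * A.charpoly - (A.charpoly /ₘ g) * g := by
      linear_combination hsplit
    rw [e, polyVec_sub, polyVec_charpoly_mul, zero_sub]
    exact (dvd_polyVec_mul hgA _ i).neg_right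
  obtain ⟨t, ht⟩ := hρ
  have hfd : A.charpoly.natDegree = n := by
    rw [Matrix.charpoly_natDegree_eq_dim, Fintype.card_fin]
  have hqd : (A.charpoly /ₘ g).natDegree = 1 := by
    rw [natDegree_divByMonic _ hg, hfd, hgd]
    omega
  have hqm : (A.charpoly /ₘ g).Monic := by
    rw [Monic, leadingCoeff_divByMonic_of_monic hg, A.charpoly_monic.leadingCoeff]
    rw [degree_eq_natDegree hg.ne_zero, degree_eq_natDegree A.charpoly_monic.ne_zero, hfd, hgd]
    exact_mod_cast Nat.sub_le n 1
  refine ⟨(A.charpoly /ₘ g).coeff 0, t, ?_⟩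
  rw [← hqm.eq_X_add_C hqd]
  linear_combination hsplit - ht

lemma exists_common_monic_of_not_sq_dvd [Fact p.Prime] (hA : A.IsSymm)
    (hchar : B.charpoly = A.charpoly)
    (hmom : ∀ k, moment A (X ^ k) = moment B (X ^ k)) (hn : n ≠ 0)
    (hpA : (p : ℤ) ∣ (walkMatrix A).det) (hpA2 : ¬ (p : ℤ) ^ 2 ∣ (walkMatrix A).det)
    (hpB : (p : ℤ) ∣ (walkMatrix B).det) (hpB2 : ¬ (p : ℤ) ^ 2 ∣ (walkMatrix B).det) :
    ∃ g : ℤ[X], g.Monic ∧ g.natDegree = n - 1 ∧ (∀ i, (p : ℤ) ∣ polyVec A g i) ∧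
      ∀ i, (p : ℤ) ∣ polyVec B g i := by
  have hp : Prime (p : ℤ) := Nat.prime_iff_prime_int.1 (Fact.out : p.Prime)
  have hp0 : (p : ℤ) ≠ 0 := hp.ne_zero
  obtain ⟨g, hg, hgd, hgA⟩ := exists_monic_of_dvd_det hn hpA
  obtain ⟨h, hh, hhd, hhB⟩ := exists_monic_of_dvd_det hn hpB
  have hMA : ¬ (p : ℤ) ∣ (localBasis A p (n - 1) g).det := fun hd => hpA2 <| by
    rw [det_walkMatrix_eq hg hgd hgA (Nat.sub_le n 1), Nat.sub_sub_self (Nat.pos_of_ne_zero hn),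
      pow_one, sq]
    exact mul_dvd_mul hd dvd_rfl
  have hMB : ¬ (p : ℤ) ∣ (localBasis B p (n - 1) h).det := fun hd => hpB2 <| by
    rw [det_walkMatrix_eq hh hhd hhB (Nat.sub_le n 1), Nat.sub_sub_self (Nat.pos_of_ne_zero hn),
      pow_one, sq]
    exact mul_dvd_mul hd dvd_rfl
  obtain ⟨a, s, has⟩ := exists_charpoly_factor hg hgd hn hgA hMA
  obtain ⟨b, t, hbt⟩ := exists_charpoly_factor hh hhd hn hhB hMB
  rw [hchar] at hbt
  have momA_dvd (r : ℤ[X]) : (p : ℤ) ∣ moment A (r * g) :=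
    Finset.dvd_sum fun i _ => dvd_polyVec_mul hgA r i
  have momB_dvd (r : ℤ[X]) : (p : ℤ) ∣ moment A (r * h) := by
    rw [moment_congr hmom]
    exact Finset.dvd_sum fun i _ => dvd_polyVec_mul hhB r i
  by_cases hab : (p : ℤ) ∣ a - b
  · refine ⟨g, hg, hgd, hgA, ?_⟩
    have hgh : C (p : ℤ) ∣ g - h := by
      obtain ⟨w, hw⟩ := hab
      have hw' : (C a - C b : ℤ[X]) = C (p : ℤ) * C w := by rw [← C_sub, hw, C_mul]
      have h1 : C (p : ℤ) ∣ (X + C a) * (g - h) :=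
        ⟨t - s - C w * h, by linear_combination has - hbt - h * hw'⟩
      rw [C_natCast_dvd_iff_map_eq_zero] at h1 ⊢
      rw [Polynomial.map_mul] at h1
      refine (mul_eq_zero.1 h1).resolve_left ?_
      exact ((monic_X_add_C a).map _).ne_zero
    intro i
    rw [show g = (g - h) + h by ring, polyVec_add]
    exact dvd_add (dvd_polyVec_of_C_dvd hgh i) (hhB i)
  · refine ⟨h, hh, hhd, ?_, hhB⟩
    have hgh : (p : ℤ) * p ∣ moment A (h * g) := by
      have e : C (a - b) * (h * g) = (h - g) * A.charpoly
          + (C (p : ℤ) * (t * g) - C (p : ℤ) * (s * h)) := by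
        rw [C_sub]
        linear_combination h * has - g * hbt
      have h1 := congrArg (moment A) e
      rw [moment_add, moment_mul_charpoly, zero_add, moment_sub, moment_C_mul, moment_C_mul,
        moment_C_mul] at h1
      have h2 : (p : ℤ) * p ∣ (a - b) * moment A (h * g) := by
        rw [h1]
        exact dvd_sub (mul_dvd_mul dvd_rfl (momA_dvd t)) (mul_dvd_mul dvd_rfl (momB_dvd s))
      have hcop : IsCoprime ((p : ℤ) * p) (a - b) := by
        have := (Irreducible.coprime_iff_not_dvd hp.irreducible).2 hab
        exact this.mul_left this
      exact hcop.dvd_of_dvd_mul_left h2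
    refine dvd_of_dvd_mulVec (M := (localBasis A p (n - 1) g)ᵀ)
      (by rwa [Matrix.det_transpose]) fun j => ?_
    have e1 : ((localBasis A p (n - 1) g)ᵀ *ᵥ polyVec A h) j
        = ∑ i, localBasis A p (n - 1) g i j * polyVec A h i := rfl
    rw [e1]
    rcases lt_or_ge (j : ℕ) (n - 1) with hj | hj
    · have e2 : ∑ i, localBasis A p (n - 1) g i j * polyVec A h i
          = moment A (X ^ (j : ℕ) * h) := by
        rw [← polyVec_dotProduct hA]
        simp [localBasis, hj, dotProduct]
      rw [e2]
      exact momB_dvd _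
    · have hj' : (j : ℕ) - (n - 1) = 0 := by omega
      have e2 : p * ∑ i, localBasis A p (n - 1) g i j * polyVec A h i = moment A (h * g) := by
        rw [mul_comm h, ← polyVec_dotProduct hA, Finset.mul_sum, dotProduct]
        refine Finset.sum_congr rfl fun i _ => ?_
        rw [← mul_assoc, localBasis, Matrix.of_apply, if_neg hj.not_gt, hj', pow_zero, one_mul,
          Int.mul_ediv_cancel' (hgA i)]
      exact (mul_dvd_mul_iff_left hp0).1 (e2 ▸ hgh)

end SimplePrimes

section Assembly

variable {A B : Matrix (Fin n) (Fin n) ℤ}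

lemma transpose_mul_self_walkMatrix_congr (hA : A.IsSymm) (hB : B.IsSymm)
    (hmom : ∀ k, moment A (X ^ k) = moment B (X ^ k)) :
    (walkMatrix B)ᵀ * walkMatrix B = (walkMatrix A)ᵀ * walkMatrix A := by
  ext i j
  rw [walkMatrix_transpose_mul_self hA, walkMatrix_transpose_mul_self hB, hmom]

lemma det_walkMatrix_congr (hA : A.IsSymm) (hB : B.IsSymm)
    (hmom : ∀ k, moment A (X ^ k) = moment B (X ^ k)) :
    (walkMatrix B).det = (walkMatrix A).det ∨ (walkMatrix B).det = -(walkMatrix A).det := by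
  have := congrArg Matrix.det (transpose_mul_self_walkMatrix_congr hA hB hmom)
  rw [Matrix.det_mul, Matrix.det_mul, Matrix.det_transpose, Matrix.det_transpose] at this
  exact mul_self_eq_mul_self_iff.1 this

/-- If the denominators of `V * W⁻¹` avoid every prime, then `V * W⁻¹` is integral. -/
lemma exists_mul_eq_of_forall_prime {V W : Matrix (Fin n) (Fin n) ℤ}
    (h : ∀ p : ℕ, p.Prime → ∃ d : ℤ, ¬ (p : ℤ) ∣ d ∧ ∃ Y, Y * W = d • V) :
    ∃ Q, Q * W = V := by
  let I : Ideal ℤ :=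
    { carrier := {d | ∃ Y, Y * W = d • V}
      zero_mem' := ⟨0, by simp⟩
      add_mem' := by
        rintro a b ⟨Y, hY⟩ ⟨Z, hZ⟩
        exact ⟨Y + Z, by rw [add_mul, hY, hZ, add_smul]⟩
      smul_mem' := by
        rintro c a ⟨Y, hY⟩
        exact ⟨c • Y, by rw [smul_mul_assoc, hY, smul_smul, smul_eq_mul]⟩ }
  obtain ⟨m, hm⟩ := (IsPrincipalIdealRing.principal I).principal
  have hmI : ∀ d, d ∈ I ↔ m ∣ d := fun d => by rw [hm]; exact Ideal.mem_span_singleton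
  have hu : m.natAbs = 1 := by
    by_contra hne
    obtain ⟨p, hp, hpm⟩ := Nat.exists_prime_and_dvd hne
    obtain ⟨d, hd, hY⟩ := h p hp
    exact hd ((Int.natCast_dvd.2 hpm).trans ((hmI d).1 hY))
  obtain ⟨Q, hQ⟩ := (hmI 1).2 (Int.isUnit_iff_natAbs_eq.2 hu).dvd
  exact ⟨Q, by rw [hQ, one_smul]⟩

/-- The rational orthogonal matrix relating the two walk matrices is integral. -/
lemma exists_mul_walkMatrix_eq (hA : IsAdjacencyMatrix A) (hB : IsAdjacencyMatrix B)
    (hchar : B.charpoly = A.charpoly) (hmom : ∀ k, moment A (X ^ k) = moment B (X ^ k)) {u : ℤ}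
    (hu : Odd u) (hsf : Squarefree u) (hdet : (walkMatrix A).det = u * 2 ^ (n / 2)) :
    ∃ Q, Q * walkMatrix B = walkMatrix A := by
  have hdvd (m : ℤ) : m ∣ (walkMatrix B).det ↔ m ∣ (walkMatrix A).det := by
    rcases det_walkMatrix_congr hA.1 hB.1 hmom with h | h <;> rw [h]
    exact dvd_neg
  have hu2 : ¬ (2 : ℤ) ∣ u := fun h => (Int.not_even_iff_odd.2 hu) (even_iff_two_dvd.2 h)
  refine exists_mul_eq_of_forall_prime fun p hp => ?_
  have : Fact p.Prime := ⟨hp⟩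
  have hpZ : Prime (p : ℤ) := Nat.prime_iff_prime_int.1 hp
  by_cases hpdvd : (p : ℤ) ∣ (walkMatrix B).det
  swap
  · refine ⟨_, hpdvd, walkMatrix A * (walkMatrix B).adjugate, ?_⟩
    rw [mul_assoc, Matrix.adjugate_mul, mul_smul_comm, mul_one]
  have hpA := (hdvd p).1 hpdvd
  rcases eq_or_ne p 2 with rfl | hp2
  · obtain ⟨g, hg, hgd, hgA, hgB⟩ := exists_common_monic_two hA hB hmom hu2 hdet
    refine ⟨_, fun h => hu2 ?_, exists_mul_walkMatrix_eq_smul hg hgd hgA hgB⟩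
    have h1 : (2 : ℤ) * 2 ^ (n / 2) ∣ (walkMatrix A).det := by
      rw [← hdvd, det_walkMatrix_eq hg hgd hgB (by omega),
        show n - (n + 1) / 2 = n / 2 by omega]
      exact mul_dvd_mul h dvd_rfl
    rw [hdet] at h1
    exact (mul_dvd_mul_iff_right (by positivity)).1 h1
  · have hn : n ≠ 0 := by
      rintro rfl
      rw [Matrix.det_isEmpty] at hpdvd
      exact hpZ.not_isUnit (isUnit_of_dvd_one hpdvd)
    have hpA2 : ¬ (p : ℤ) ^ 2 ∣ (walkMatrix A).det := fun h => by
      rw [hdet] at h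
      have hcop : IsCoprime ((p : ℤ) ^ 2) (2 ^ (n / 2)) := by
        refine IsCoprime.pow (Nat.isCoprime_iff_coprime.2 ?_)
        exact (Nat.coprime_primes hp Nat.prime_two).2 hp2
      have := hcop.dvd_of_dvd_mul_right h
      rw [sq] at this
      exact hpZ.not_isUnit (hsf _ this)
    have hpB2 : ¬ (p : ℤ) ^ 2 ∣ (walkMatrix B).det := by rwa [hdvd]
    obtain ⟨g, hg, hgd, hgA, hgB⟩ :=
      exists_common_monic_of_not_sq_dvd hA.1 hchar hmom hn hpA hpA2 hpdvd hpB2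
    refine ⟨_, fun h => hpB2 ?_, exists_mul_walkMatrix_eq_smul hg hgd hgA hgB⟩
    rw [det_walkMatrix_eq hg hgd hgB (Nat.sub_le n 1), Nat.sub_sub_self (Nat.pos_of_ne_zero hn),
      pow_one, sq]
    exact mul_dvd_mul h dvd_rfl

lemma mul_right_cancel_of_det_ne_zero {W M N : Matrix (Fin n) (Fin n) ℤ} (hW : W.det ≠ 0)
    (h : M * W = N * W) : M = N := by
  have := congrArg (· * W.adjugate) h
  simp only [mul_assoc, Matrix.mul_adjugate, mul_smul_comm, mul_one] at this
  exact smul_right_injective _ hW this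

lemma mulVec_polyVec {Q : Matrix (Fin n) (Fin n) ℤ} (hchar : B.charpoly = A.charpoly)
    (hQ : Q * walkMatrix B = walkMatrix A) (r : ℤ[X]) : Q *ᵥ polyVec B r = polyVec A r := by
  have hr : (r %ₘ A.charpoly).degree < n := by
    have := degree_modByMonic_lt r A.charpoly_monic
    rwa [degree_eq_natDegree A.charpoly_monic.ne_zero, Matrix.charpoly_natDegree_eq_dim,
      Fintype.card_fin] at this
  have eA : polyVec A r = polyVec A (r %ₘ A.charpoly) := by
    rw [polyVec, Matrix.aeval_eq_aeval_mod_charpoly, polyVec]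
  have eB : polyVec B r = polyVec B (r %ₘ A.charpoly) := by
    rw [polyVec, Matrix.aeval_eq_aeval_mod_charpoly, polyVec, hchar]
  rw [eA, eB, polyVec_eq_walkMatrix_mulVec hr, polyVec_eq_walkMatrix_mulVec hr,
    Matrix.mulVec_mulVec, hQ]

lemma mul_eq_mul_of_mul_walkMatrix {Q : Matrix (Fin n) (Fin n) ℤ} (hdet : (walkMatrix B).det ≠ 0)
    (hchar : B.charpoly = A.charpoly) (hQ : Q * walkMatrix B = walkMatrix A) : A * Q = Q * B := by
  refine mul_right_cancel_of_det_ne_zero hdet ?_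
  have hstep (M : Matrix (Fin n) (Fin n) ℤ) (i j : Fin n) :
      (M * walkMatrix M) i j = polyVec M (X * X ^ (j : ℕ)) i := by
    rw [polyVec_mul, aeval_X]
    simp [Matrix.mul_apply, Matrix.mulVec, dotProduct, walkMatrix_apply]
  rw [mul_assoc, mul_assoc, hQ]
  ext i j
  rw [hstep, ← mulVec_polyVec hchar hQ, Matrix.mul_apply, Matrix.mulVec, dotProduct]
  exact Finset.sum_congr rfl fun k _ => by rw [hstep]

lemma transpose_mul_self_eq_one {Q V W : Matrix (Fin n) (Fin n) ℤ} (hdet : W.det ≠ 0)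
    (hQ : Q * W = V) (hgram : Wᵀ * W = Vᵀ * V) : Qᵀ * Q = 1 := by
  refine mul_right_cancel_of_det_ne_zero hdet ?_
  rw [← Matrix.transpose_inj]
  refine mul_right_cancel_of_det_ne_zero hdet ?_
  rw [one_mul, hgram, ← hQ]
  simp only [Matrix.transpose_mul, Matrix.transpose_transpose, mul_assoc]

/-- An integral orthogonal matrix fixing the all-ones vector is a permutation matrix. -/
lemma exists_eq_permMatrix {Q : Matrix (Fin n) (Fin n) ℤ} (hQ : Qᵀ * Q = 1)
    (hone : Q *ᵥ (fun _ => (1 : ℤ)) = fun _ => 1) :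
    ∃ σ : Equiv.Perm (Fin n), σ.permMatrix ℤ = Q := by
  have hQ' : Q * Qᵀ = 1 := mul_eq_one_comm.1 hQ
  have hrow (i : Fin n) : ∑ j, Q i j = 1 := by
    simpa [Matrix.mulVec, dotProduct] using congrFun hone i
  have hrowsq (i : Fin n) : ∑ j, Q i j * Q i j = 1 := by
    simpa [Matrix.mul_apply] using congrFun (congrFun hQ' i) i
  have hcol (j : Fin n) : ∑ i, Q i j * Q i j = 1 := by
    simpa [Matrix.mul_apply] using congrFun (congrFun hQ j) j
  have hnonneg (a : ℤ) : 0 ≤ a * a - a := by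
    rcases le_or_gt a 0 with h | h <;> nlinarith
  have h01 (i j : Fin n) : Q i j = 0 ∨ Q i j = 1 := by
    have hsum : ∑ j, (Q i j * Q i j - Q i j) = 0 := by
      rw [Finset.sum_sub_distrib, hrow, hrowsq, sub_self]
    have := (Finset.sum_eq_zero_iff_of_nonneg fun j _ => hnonneg (Q i j)).1 hsum j
      (Finset.mem_univ j)
    have h : Q i j * (Q i j - 1) = 0 := by linarith
    exact (mul_eq_zero.1 h).imp_right sub_eq_zero.1
  have hex (i : Fin n) : ∃ j, Q i j = 1 := by
    by_contra! h
    have := hrow i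
    rw [Finset.sum_eq_zero fun j _ => (h01 i j).resolve_right (h j)] at this
    exact zero_ne_one this
  choose τ hτ using hex
  have horth {i j k : Fin n} (hij : Q i k = 1) (hjk : Q j k = 1) : i = j := by
    by_contra hne
    have := Finset.add_le_sum (f := fun i => Q i k * Q i k) (fun i _ => mul_self_nonneg _)
      (Finset.mem_univ i) (Finset.mem_univ j) hne
    rw [hcol k, hij, hjk] at this
    norm_num at this
  have hτinj : Function.Injective τ := fun i j hij => horth (hτ i) (hij ▸ hτ j)
  have huniq {i j : Fin n} (h : Q i j = 1) : τ i = j := by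
    by_contra hne
    have := Finset.add_le_sum (f := fun j => Q i j * Q i j) (fun i _ => mul_self_nonneg _)
      (Finset.mem_univ (τ i)) (Finset.mem_univ j) hne
    rw [hrowsq i, h, hτ i] at this
    norm_num at this
  refine ⟨Equiv.ofBijective τ (Finite.injective_iff_bijective.1 hτinj), ?_⟩
  ext i j
  rw [Equiv.Perm.permMatrix, PEquiv.toMatrix_apply]
  simp only [Equiv.toPEquiv_apply, Equiv.ofBijective_apply, Option.mem_some_iff]
  split_ifs with h
  · rw [← h, hτ]
  · exact ((h01 i j).resolve_right fun h1 => h (huniq h1)).symm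

end Assembly

end

theorem stmt0 {n : ℕ} (A : Matrix (Fin n) (Fin n) ℤ)
    (hA : IsAdjacencyMatrix A)
    (hdvd : (2 : ℤ) ^ (n / 2) ∣ (walkMatrix A).det)
    (hodd : Odd ((walkMatrix A).det / 2 ^ (n / 2)))
    (hsf : Squarefree ((walkMatrix A).det / 2 ^ (n / 2))) :
    ∀ B : Matrix (Fin n) (Fin n) ℤ, IsAdjacencyMatrix B →
      B.charpoly = A.charpoly →
      ((Matrix.of fun _ _ => (1 : ℤ)) - 1 - B).charpoly
        = ((Matrix.of fun _ _ => (1 : ℤ)) - 1 - A).charpoly →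
      ∃ σ : Equiv.Perm (Fin n),
        (σ.permMatrix ℤ)ᵀ * A * σ.permMatrix ℤ = B := by
  intro B hB hchar hcompl
  have hmom := moment_X_pow_congr hchar hcompl
  have hdet : (walkMatrix A).det = (walkMatrix A).det / 2 ^ (n / 2) * 2 ^ (n / 2) :=
    (Int.ediv_mul_cancel hdvd).symm
  have hdetA : (walkMatrix A).det ≠ 0 := by
    intro h
    rw [h, Int.zero_ediv] at hsf
    exact not_squarefree_zero hsf
  have hdetB : (walkMatrix B).det ≠ 0 := by
    rcases det_walkMatrix_congr hA.1 hB.1 hmom with h | h <;> rw [h]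
    · exact hdetA
    · exact neg_ne_zero.2 hdetA
  obtain ⟨Q, hQ⟩ := exists_mul_walkMatrix_eq hA hB hchar hmom hodd hsf hdet
  have hQQ : Qᵀ * Q = 1 := transpose_mul_self_eq_one hdetB hQ
    (transpose_mul_self_walkMatrix_congr hA.1 hB.1 hmom)
  have hone : Q *ᵥ (fun _ => (1 : ℤ)) = fun _ => 1 := by
    simpa [polyVec] using mulVec_polyVec hchar hQ 1
  obtain ⟨σ, rfl⟩ := exists_eq_permMatrix hQQ hone
  refine ⟨σ, ?_⟩
  rw [mul_assoc, mul_eq_mul_of_mul_walkMatrix hdetB hchar hQ, ← mul_assoc, hQQ, one_mul]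
end

section
/- Let T be a tree on n vertices whose adjacency matrix A_T has characteristic polynomial irreducible over ℚ, and suppose Δ(T) = 2^n·d² for some odd square-free positive integer d. Then every signed graph whose underlying graph is T is determined by its generalized spectrum among signed graphs: if A is the adjacency matrix of a signed graph with underlying graph T, and B is the adjacency matrix of any signed graph on n vertices with det(xI−B)=det(xI−A) and det(xI−(J−I−B))=det(xI−(J−I−A)), then there exists a permutation matrix P with PᵀAP = B. -/
open Matrix Polynomial
open scoped Classical

/-- An enumeration of the complex roots (with multiplicity) of a polynomial that has
exactly `n` roots, obtained by choice (and junk otherwise). -/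
noncomputable def rootsEnum (n : ℕ) (f : Polynomial ℂ) : Fin n → ℂ :=
  if h : ∃ α : Fin n → ℂ, f.roots = Multiset.map α Finset.univ.val then h.choose
  else fun _ => 0

/-- The discriminant `∏_{i<j} (αᵢ - αⱼ)²` of a polynomial with `n` complex roots
`α₁, …, αₙ` listed with multiplicity. -/
noncomputable def polyDisc (n : ℕ) (f : Polynomial ℂ) : ℂ :=
  ∏ i : Fin n, ∏ j ∈ Finset.univ.filter (fun j => i < j),
    (rootsEnum n f i - rootsEnum n f j) ^ 2

/-- The adjacency matrix of a signed graph: a symmetric integer matrix with zero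
diagonal and all entries in `{-1, 0, 1}`. -/
def IsSignedAdjMatrix {n : ℕ} (A : Matrix (Fin n) (Fin n) ℤ) : Prop :=
  A.IsSymm ∧ (∀ i, A i i = 0) ∧ ∀ i j, A i j = -1 ∨ A i j = 0 ∨ A i j = 1

/-- The characteristic polynomial of an endomorphism is the product of those it induces on an
invariant subspace and on the quotient. -/
theorem LinearMap.charpoly_eq_restrict_mul_mapQ {F V : Type*} [Field F] [AddCommGroup V]
    [Module F V] [Module.Finite F V] (W : Submodule F V) (e : V →ₗ[F] V) (he : W ≤ W.comap e) :
    e.charpoly = (e.restrict he).charpoly * (W.mapQ W e he).charpoly := by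
  let bW := Module.Free.chooseBasis F W
  let bQ := Module.Free.chooseBasis F (V ⧸ W)
  let b := Module.Basis.sumQuot bW bQ
  have h : LinearMap.toMatrix b b e = Matrix.fromBlocks (LinearMap.toMatrix bW bW (e.restrict he))
      (Matrix.of fun i l ↦ (b.repr (e (b (Sum.inr l)))) (Sum.inl i)) 0
      (LinearMap.toMatrix bQ bQ (W.mapQ W e he)) := by
    ext u v
    cases u with
    | inl i =>
      cases v with
      | inl k =>
        simp only [b, Module.Basis.sumQuot_inl, Matrix.fromBlocks_apply₁₁, LinearMap.toMatrix_apply]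
        apply Module.Basis.sumQuot_repr_inl_of_mem
      | inr l => simp [b, LinearMap.toMatrix_apply, Matrix.fromBlocks_apply₁₂]
    | inr j =>
      cases v with
      | inl k =>
        suffices W.mkQ (e (bW k)) = 0 by simp [LinearMap.toMatrix_apply, b, this]
        rw [← LinearMap.mem_ker, Submodule.ker_mkQ]
        exact he (Submodule.coe_mem (bW k))
      | inr l =>
        simp only [LinearMap.toMatrix_apply, Module.Basis.sumQuot_repr_inr,
          Matrix.fromBlocks_apply₂₂, b]
        rw [← Module.Basis.sumQuot_inr bW bQ l, W.mapQ_apply]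
        simp
  rw [← LinearMap.charpoly_toMatrix e b, h, Matrix.charpoly_fromBlocks_zero₂₁,
    LinearMap.charpoly_toMatrix, LinearMap.charpoly_toMatrix]

theorem Matrix.toLin'_aeval {F ι : Type*} [Field F] [Fintype ι] [DecidableEq ι]
    (A : Matrix ι ι F) (f : F[X]) : (aeval A f).toLin' = aeval A.toLin' f :=
  (Polynomial.aeval_algHom_apply (Matrix.toLinAlgEquiv' (R := F) (n := ι)).toAlgHom A f).symm

theorem Matrix.IsSymm.aeval {F ι : Type*} [CommRing F] [Fintype ι] [DecidableEq ι]
    {A : Matrix ι ι F} (hA : A.IsSymm) (f : F[X]) : (aeval A f).IsSymm := by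
  induction f using Polynomial.induction_on' with
  | add p q hp hq => simpa using hp.add hq
  | monomial n a =>
    rw [aeval_monomial, ← Algebra.smul_def]
    exact (hA.pow n).smul a

theorem Matrix.exists_charpoly_eq_mul_of_invariant {F ι : Type*} [Field F] [Fintype ι]
    [DecidableEq ι] (A : Matrix ι ι F) (W : Submodule F (ι → F)) (hW : ∀ w ∈ W, A *ᵥ w ∈ W) :
    ∃ g q : F[X], A.charpoly = g * q ∧ g.natDegree = Module.finrank F W ∧
      (∀ w ∈ W, aeval A g *ᵥ w = 0) ∧ ∀ u, aeval A q *ᵥ u ∈ W := by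
  have he : W ≤ W.comap A.toLin' := fun w hw => by simpa using hW w hw
  refine ⟨(A.toLin'.restrict he).charpoly, (W.mapQ W A.toLin' he).charpoly, ?_, ?_, ?_, ?_⟩
  · rw [← LinearMap.charpoly_eq_restrict_mul_mapQ, Matrix.charpoly_toLin']
  · rw [LinearMap.charpoly_natDegree]
  · intro w hw
    have key : ∀ f : F[X], aeval A f *ᵥ w = (aeval (A.toLin'.restrict he) f ⟨w, hw⟩ : W) := by
      intro f
      rw [← Matrix.toLin'_apply, Matrix.toLin'_aeval]
      induction f using Polynomial.induction_on' with
      | add p q hp hq => simp only [map_add, LinearMap.add_apply, hp, hq, Submodule.coe_add]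
      | monomial n a =>
        have : ∀ v : W, (A.toLin' ^ n) v = ((A.toLin'.restrict he) ^ n) v := by
          induction n with
          | zero => simp
          | succ n ih =>
            intro v
            rw [pow_succ, pow_succ, Module.End.mul_apply, Module.End.mul_apply, ← ih]
            rfl
        simp only [aeval_monomial, Module.End.mul_apply, Module.algebraMap_end_apply,
          Submodule.coe_smul, ← this]
    rw [key, LinearMap.aeval_self_charpoly]; rfl
  · intro u
    have key : ∀ f : F[X], W.mkQ (aeval A f *ᵥ u) = aeval (W.mapQ W A.toLin' he) f (W.mkQ u) := by
      intro f
      rw [← Matrix.toLin'_apply, Matrix.toLin'_aeval]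
      induction f using Polynomial.induction_on' with
      | add p q hp hq => simp only [map_add, LinearMap.add_apply, hp, hq]
      | monomial n a =>
        have : ∀ v, W.mkQ ((A.toLin' ^ n) v) = (W.mapQ W A.toLin' he ^ n) (W.mkQ v) := by
          induction n with
          | zero => simp
          | succ n ih =>
            intro v
            rw [pow_succ, pow_succ, Module.End.mul_apply, Module.End.mul_apply, ih]
            rfl
        simp only [aeval_monomial, Module.End.mul_apply, Module.algebraMap_end_apply, map_smul,
          this]
    refine (Submodule.Quotient.mk_eq_zero W).mp ?_
    rw [← Submodule.mkQ_apply, key, LinearMap.aeval_self_charpoly]; rfl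

theorem Matrix.eq_bot_or_eq_top_of_irreducible_charpoly {F ι : Type*} [Field F] [Fintype ι]
    [DecidableEq ι] {A : Matrix ι ι F} (hA : Irreducible A.charpoly) (W : Submodule F (ι → F))
    (hW : ∀ w ∈ W, A *ᵥ w ∈ W) : W = ⊥ ∨ W = ⊤ := by
  obtain ⟨g, q, h, hg, hgW, hqW⟩ := A.exists_charpoly_eq_mul_of_invariant W hW
  rcases hA.isUnit_or_isUnit h with hu | hu
  · left
    rw [← Submodule.finrank_eq_zero (R := F), ← hg]
    exact Polynomial.natDegree_eq_zero_of_isUnit hu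
  · right
    obtain ⟨c, hc, rfl⟩ := Polynomial.isUnit_iff.mp hu
    rw [eq_top_iff]
    intro u _
    have := hqW (c⁻¹ • u)
    simpa [Algebra.algebraMap_eq_smul_one, smul_mulVec, smul_smul, hc.ne_zero] using this

/-- If a symmetric matrix over a field preserves a totally isotropic subspace, then the derivative
of its characteristic polynomial, evaluated at the matrix, kills that subspace. -/
theorem Matrix.aeval_derivative_charpoly_mulVec_eq_zero {F ι : Type*} [Field F] [Fintype ι]
    [DecidableEq ι] {A : Matrix ι ι F} (hA : A.IsSymm) (W : Submodule F (ι → F))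
    (hW : ∀ w ∈ W, A *ᵥ w ∈ W) (hiso : ∀ v ∈ W, ∀ w ∈ W, v ⬝ᵥ w = 0) {w : ι → F} (hw : w ∈ W) :
    aeval A (derivative A.charpoly) *ᵥ w = 0 := by
  obtain ⟨g, q, h, -, hgW, hqW⟩ := A.exists_charpoly_eq_mul_of_invariant W hW
  have hq : aeval A q *ᵥ w = 0 := by
    refine dotProduct_eq_zero _ fun u => ?_
    rw [dotProduct_comm, Matrix.dotProduct_mulVec, ← Matrix.mulVec_transpose,
      (hA.aeval q).eq]
    exact hiso _ (hqW u) _ hw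
  rw [h, derivative_mul, mul_comm g, map_add, map_mul, map_mul, Matrix.add_mulVec,
    ← Matrix.mulVec_mulVec, ← Matrix.mulVec_mulVec, hgW w hw, hq]
  simp

/-- If an integer matrix has a column and a row, of the same index, divisible by `p`, and the common
entry is divisible by `p ^ 2`, then so is the determinant. -/
theorem Matrix.sq_dvd_det_of_row_col {ι : Type*} [Fintype ι] [DecidableEq ι] (E : Matrix ι ι ℤ)
    (p : ℤ) (i : ι) (hrow : ∀ j, p ∣ E i j) (hcol : ∀ j, p ∣ E j i) (hii : p ^ 2 ∣ E i i) :
    p ^ 2 ∣ E.det := by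
  rw [Matrix.det_apply]
  refine Finset.dvd_sum fun σ _ => ?_
  rw [Units.smul_def, smul_eq_mul]
  refine Dvd.dvd.mul_left ?_ _
  by_cases h : σ i = i
  · exact (by rw [h]; exact hii : p ^ 2 ∣ E (σ i) i).trans
      (Finset.dvd_prod_of_mem _ (Finset.mem_univ i))
  · have hne : σ.symm i ≠ i := fun h' => h (by rw [Equiv.symm_apply_eq] at h'; exact h'.symm)
    rw [← Finset.mul_prod_erase _ _ (Finset.mem_univ i), pow_two]
    refine mul_dvd_mul (hcol _) ?_
    refine (?_ : p ∣ E (σ (σ.symm i)) (σ.symm i)).trans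
      (Finset.dvd_prod_of_mem (fun k => E (σ k) k) (Finset.mem_erase.mpr ⟨hne, Finset.mem_univ _⟩))
    rw [Equiv.apply_symm_apply]
    exact hrow _

theorem Matrix.sq_dvd_det_of_isSymm {ι : Type*} [Fintype ι] [DecidableEq ι] {E : Matrix ι ι ℤ}
    (hE : E.IsSymm) {p : ℤ} (hp : Prime p) {v : ι → ℤ} {i : ι} (hv : ¬ p ∣ v i)
    (hEv : ∀ j, p ∣ (E *ᵥ v) j) (hvEv : p ^ 2 ∣ v ⬝ᵥ E *ᵥ v) : p ^ 2 ∣ E.det := by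
  set P : Matrix ι ι ℤ := (1 : Matrix ι ι ℤ).updateCol i v with hP
  have hPi : P *ᵥ Pi.single i 1 = v := by
    ext j; simp [hP]
  have hdet : P.det = v i := by
    rw [hP, ← Matrix.cramer_apply, Matrix.cramer_one]; rfl
  have hcol : ∀ j, p ∣ (Pᵀ * E * P) j i := by
    intro j
    have : (Pᵀ * E * P) j i = (Pᵀ *ᵥ (E *ᵥ v)) j := by
      rw [← hPi, Matrix.mulVec_mulVec, Matrix.mulVec_mulVec]; simp [Matrix.mul_assoc]
    rw [this]
    exact Finset.dvd_sum fun k _ => Dvd.dvd.mul_left (hEv k) _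
  have hsymm : (Pᵀ * E * P).IsSymm := by
    simp [Matrix.IsSymm, Matrix.transpose_mul, hE.eq, Matrix.mul_assoc]
  have key : p ^ 2 ∣ (Pᵀ * E * P).det := by
    refine Matrix.sq_dvd_det_of_row_col _ p i (fun j => ?_) hcol ?_
    · rw [← hsymm.apply]; exact hcol j
    · have : (Pᵀ * E * P) i i = v ⬝ᵥ E *ᵥ v := by
        have h1 : (Pᵀ * E * P) i i = (Pᵀ *ᵥ (E *ᵥ v)) i := by
          rw [← hPi, Matrix.mulVec_mulVec, Matrix.mulVec_mulVec]; simp [Matrix.mul_assoc]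
        rw [h1]
        change (fun j => P j i) ⬝ᵥ _ = _
        congr 1
        ext j; simp [hP]
      rw [this]; exact hvEv
  rw [Matrix.det_mul, Matrix.det_mul, Matrix.det_transpose, hdet] at key
  have hc : IsCoprime (p ^ 2) (v i) :=
    IsCoprime.pow_left ((hp.coprime_iff_not_dvd).mpr hv)
  exact hc.dvd_of_dvd_mul_left (hc.dvd_of_dvd_mul_right key)

theorem Matrix.map_aeval {R S ι : Type*} [CommRing R] [CommRing S] [Fintype ι] [DecidableEq ι]
    (φ : R →+* S) (A : Matrix ι ι R) (f : R[X]) :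
    (aeval A f).map φ = aeval (A.map φ) (f.map φ) :=
  Polynomial.map_aeval_eq_aeval_map (ψ := φ.mapMatrix)
    (by ext a i j; simp [Matrix.algebraMap_matrix_apply, apply_ite φ]) f A

theorem Matrix.aeval_mul_eq_mul_aeval {R ι κ : Type*} [CommRing R] [Fintype ι] [DecidableEq ι]
    [Fintype κ] [DecidableEq κ] {A : Matrix ι ι R} {B : Matrix κ κ R} {Q : Matrix ι κ R}
    (h : A * Q = Q * B) (f : R[X]) : aeval A f * Q = Q * aeval B f := by
  induction f using Polynomial.induction_on' with
  | add p q hp hq => simp only [map_add, Matrix.add_mul, Matrix.mul_add, hp, hq]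
  | monomial n a =>
    have : A ^ n * Q = Q * B ^ n := by
      induction n with
      | zero => simp
      | succ n ih => rw [pow_succ, pow_succ, Matrix.mul_assoc, h, ← Matrix.mul_assoc, ih,
          Matrix.mul_assoc]
    simp only [aeval_monomial, ← Algebra.smul_def, Matrix.smul_mul, this, Matrix.mul_smul]

/-- If an integer matrix `Q` with `Qᵀ * Q = ℓ² • 1` intertwines `A` and `B` and is not divisible by
a prime `p ∣ ℓ`, then `p²` divides the determinant of the derivative of the characteristic
polynomial of `A` at `A`. -/
theorem Matrix.sq_dvd_det_aeval_derivative_charpoly {ι κ : Type*} [Fintype ι] [DecidableEq ι]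
    [Fintype κ] [DecidableEq κ] {A : Matrix ι ι ℤ} (hA : A.IsSymm) {B : Matrix κ κ ℤ}
    {Q : Matrix ι κ ℤ} {l : ℤ} (hAQ : A * Q = Q * B) (hQQ : Qᵀ * Q = (l ^ 2) • 1) {p : ℕ}
    (hp : p.Prime) (hpl : (p : ℤ) ∣ l) {i : ι} {k : κ} (hQ : ¬ (p : ℤ) ∣ Q i k) :
    (p : ℤ) ^ 2 ∣ (aeval A (derivative A.charpoly)).det := by
  have := Fact.mk hp
  set v : ι → ℤ := Q *ᵥ Pi.single k 1 with hv
  have hvi : v i = Q i k := by simp [hv]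
  have hl2 : (p : ℤ) ^ 2 ∣ l ^ 2 := pow_dvd_pow_of_dvd hpl 2
  refine Matrix.sq_dvd_det_of_isSymm (hA.aeval _) (Nat.prime_iff_prime_int.mp hp) (v := v) (i := i)
    (by rwa [hvi]) (fun j => ?_) ?_
  · let φ := Int.castRingHom (ZMod p)
    let W : Submodule (ZMod p) (ι → ZMod p) := LinearMap.range (Q.map φ).mulVecLin
    have hAQ' : A.map φ * Q.map φ = Q.map φ * B.map φ := by
      rw [← Matrix.map_mul, ← Matrix.map_mul, hAQ]
    have hQQ' : (Q.map φ)ᵀ * Q.map φ = 0 := by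
      rw [← Matrix.transpose_map, ← Matrix.map_mul, hQQ]
      ext a b
      have : ((l ^ 2 : ℤ) : ZMod p) = 0 :=
        (ZMod.intCast_zmod_eq_zero_iff_dvd _ _).mpr ((dvd_pow_self _ two_ne_zero).trans hl2)
      simp only [Matrix.map_apply, Matrix.smul_apply, smul_eq_mul, map_mul, Matrix.zero_apply]
      change ((l ^ 2 : ℤ) : ZMod p) * _ = 0
      rw [this, zero_mul]
    have h0 : aeval (A.map φ) (derivative (A.map φ).charpoly) *ᵥ (fun j => φ (v j)) = 0 := by
      refine Matrix.aeval_derivative_charpoly_mulVec_eq_zero (W := W) (hA.map φ) ?_ ?_ ?_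
      · rintro _ ⟨u, rfl⟩
        refine ⟨B.map φ *ᵥ u, ?_⟩
        simp only [Matrix.mulVecLin_apply, Matrix.mulVec_mulVec, hAQ']
      · rintro _ ⟨u, rfl⟩ _ ⟨w, rfl⟩
        simp only [Matrix.mulVecLin_apply]
        rw [Matrix.dotProduct_mulVec, ← Matrix.mulVec_transpose, Matrix.mulVec_mulVec, hQQ']
        simp
      · refine ⟨Pi.single k 1, ?_⟩
        ext j
        simp [hv]
    have h1 : (aeval A (derivative A.charpoly)).map φ =
        aeval (A.map φ) (derivative (A.map φ).charpoly) := by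
      rw [Matrix.map_aeval, Matrix.charpoly_map, derivative_map]
    rw [← h1] at h0
    have := congrFun h0 j
    rw [← ZMod.intCast_zmod_eq_zero_iff_dvd]
    exact (RingHom.map_mulVec φ _ v j).trans this
  · rw [hv, Matrix.mulVec_mulVec, Matrix.aeval_mul_eq_mul_aeval hAQ, Matrix.dotProduct_mulVec,
      ← Matrix.mulVec_transpose, Matrix.mulVec_mulVec, Matrix.transpose_mul, Matrix.mul_assoc, hQQ]
    simp only [Matrix.mul_smul, Matrix.smul_mulVec, smul_dotProduct, smul_eq_mul]
    exact hl2.mul_right _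

theorem Matrix.map_intCast_mul {ι κ μ : Type*} [Fintype κ] (A : Matrix ι κ ℤ) (B : Matrix κ μ ℤ) :
    (A * B).map (Int.cast : ℤ → ℚ) = A.map (Int.cast : ℤ → ℚ) * B.map (Int.cast : ℤ → ℚ) :=
  Matrix.map_mul (f := Int.castRingHom ℚ)

theorem Matrix.exists_int_mul_eq_map {ι κ : Type*} [Fintype ι] [Fintype κ] (Q : Matrix ι κ ℚ) :
    ∃ l : ℕ, 0 < l ∧ ∃ Z : Matrix ι κ ℤ, (l : ℚ) • Q = Z.map (Int.cast : ℤ → ℚ) := by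
  refine ⟨∏ i, ∏ j, (Q i j).den, Finset.prod_pos fun i _ => Finset.prod_pos fun j _ => (Q i j).pos,
    ?_⟩
  have h : ∀ i j, ∃ z : ℤ, ((∏ i, ∏ j, (Q i j).den : ℕ) : ℚ) * Q i j = z := by
    intro i j
    obtain ⟨c, hc⟩ : (Q i j).den ∣ ∏ i, ∏ j, (Q i j).den :=
      (Finset.dvd_prod_of_mem (fun j => (Q i j).den) (Finset.mem_univ j)).trans
        (Finset.dvd_prod_of_mem (fun i => ∏ j, (Q i j).den) (Finset.mem_univ i))
    refine ⟨c * (Q i j).num, ?_⟩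
    rw [hc]
    push_cast
    rw [mul_comm ((Q i j).den : ℚ), mul_assoc, Rat.den_mul_eq_num]
  choose Z hZ using h
  exact ⟨Matrix.of Z, by ext i j; simpa using hZ i j⟩

/-- A rational matrix with orthonormal columns intertwining two integer matrices, the first of them
symmetric with a suitably square-free discriminant, is integral. -/
theorem Matrix.exists_int_eq_map_of_not_sq_dvd {ι κ : Type*} [Fintype ι] [DecidableEq ι]
    [Fintype κ] [DecidableEq κ] {A : Matrix ι ι ℤ} (hA : A.IsSymm) {B : Matrix κ κ ℤ}
    {Q : Matrix ι κ ℚ} (hAQ : A.map (Int.cast : ℤ → ℚ) * Q = Q * B.map (Int.cast : ℤ → ℚ))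
    (hQQ : Qᵀ * Q = 1)
    (hdisc : ∀ p : ℕ, p.Prime → ¬ (p : ℤ) ^ 2 ∣ (aeval A (derivative A.charpoly)).det) :
    ∃ Z : Matrix ι κ ℤ, Q = Z.map (Int.cast : ℤ → ℚ) := by
  have hex := Q.exists_int_mul_eq_map
  set l := Nat.find hex with hl
  obtain ⟨hl0, Z, hZ⟩ := Nat.find_spec hex
  rw [← hl] at hl0 hZ
  by_cases h1 : l = 1
  · exact ⟨Z, by simpa [h1] using hZ⟩
  exfalso
  obtain ⟨p, hp, c, hc⟩ := Nat.exists_prime_and_dvd h1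
  have hc0 : 0 < c := Nat.pos_of_ne_zero (by rintro rfl; simp [hc] at hl0)
  have hnd : ∃ i k, ¬ (p : ℤ) ∣ Z i k := by
    by_contra! hall
    choose Y hY using hall
    have hlt : c < l := by rw [hc]; nlinarith [hp.two_le]
    refine Nat.find_min hex hlt ⟨hc0, Matrix.of Y, ?_⟩
    ext i k
    have h2 := congrFun (congrFun hZ i) k
    simp only [Matrix.smul_apply, Matrix.map_apply, smul_eq_mul, hY, hc, Matrix.of_apply] at h2 ⊢
    push_cast at h2
    have hp0 : (p : ℚ) ≠ 0 := by exact_mod_cast hp.ne_zero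
    rw [mul_assoc] at h2
    exact mul_left_cancel₀ hp0 h2
  obtain ⟨i, k, hik⟩ := hnd
  refine hdisc p hp (Matrix.sq_dvd_det_aeval_derivative_charpoly hA (B := B) (Q := Z) (l := l)
    ?_ ?_ hp ⟨c, by exact_mod_cast hc⟩ hik)
  · apply Matrix.map_injective (Int.cast_injective (α := ℚ))
    beta_reduce
    rw [Matrix.map_intCast_mul, Matrix.map_intCast_mul, ← hZ, Matrix.mul_smul, hAQ, Matrix.smul_mul]
  · apply Matrix.map_injective (Int.cast_injective (α := ℚ))
    beta_reduce
    rw [Matrix.map_intCast_mul, Matrix.transpose_map, ← hZ, Matrix.transpose_smul, Matrix.smul_mul,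
      Matrix.mul_smul, hQQ, smul_smul]
    ext a b
    rw [Matrix.map_apply, Matrix.smul_apply, Matrix.smul_apply, smul_eq_mul, smul_eq_mul,
      Matrix.one_apply, Matrix.one_apply]
    split_ifs <;> push_cast <;> ring

theorem Matrix.det_aeval_eq_prod_roots {ι : Type*} [Fintype ι] [DecidableEq ι]
    (A : Matrix ι ι ℂ) (g : ℂ[X]) :
    (aeval A g).det = (A.charpoly.roots.map fun r => g.eval r).prod := by
  have hsplit := IsAlgClosed.splits A.charpoly
  have hcard : A.charpoly.roots.card = Fintype.card ι := by
    rw [← hsplit.natDegree_eq_card_roots, Matrix.charpoly_natDegree_eq_dim]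
  have hg : g ∈ Submonoid.closure ({C a | a : ℂ} ∪ {X + C a | a : ℂ}) := IsAlgClosed.splits g
  induction hg using Submonoid.closure_induction with
  | mem x hx =>
    rcases hx with ⟨a, rfl⟩ | ⟨a, rfl⟩
    · simp [Algebra.algebraMap_eq_smul_one, hcard]
    · have h1 : aeval A (X + C a) = -(Matrix.scalar ι (-a) - A) := by
        ext i j
        by_cases hij : i = j <;> simp [Matrix.algebraMap_matrix_apply, hij, add_comm]
      rw [h1, Matrix.det_neg, ← Matrix.eval_charpoly]
      conv_lhs => rw [hsplit.eq_prod_roots_of_monic A.charpoly_monic]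
      rw [Polynomial.eval_multiset_prod, Multiset.map_map, ← hcard]
      have h2 : A.charpoly.roots.map (fun r => eval r (X + C a)) =
          A.charpoly.roots.map fun r => -1 * (-a - r) :=
        Multiset.map_congr rfl fun r _ => by simp
      rw [h2, Multiset.prod_map_mul, Multiset.map_const', Multiset.prod_replicate]
      simp
  | one => simp
  | mul x y hx hy ihx ihy => simp [Matrix.det_mul, ihx, ihy]

theorem Matrix.det_aeval_congr_of_charpoly_eq {ι κ : Type*} [Fintype ι] [DecidableEq ι]
    [Fintype κ] [DecidableEq κ] {A : Matrix ι ι ℤ} {B : Matrix κ κ ℤ}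
    (h : A.charpoly = B.charpoly) (g : ℤ[X]) : (aeval A g).det = (aeval B g).det := by
  apply Int.cast_injective (α := ℂ)
  change Int.castRingHom ℂ _ = Int.castRingHom ℂ _
  rw [RingHom.map_det, RingHom.map_det, RingHom.mapMatrix_apply, RingHom.mapMatrix_apply,
    Matrix.map_aeval, Matrix.map_aeval, Matrix.det_aeval_eq_prod_roots,
    Matrix.det_aeval_eq_prod_roots, Matrix.charpoly_map, Matrix.charpoly_map, h]

theorem polyDisc_sq_eq {n : ℕ} (A : Matrix (Fin n) (Fin n) ℂ) :
    polyDisc n A.charpoly ^ 2 = (aeval A (derivative A.charpoly)).det ^ 2 := by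
  have hsplit := IsAlgClosed.splits A.charpoly
  have hcard : A.charpoly.roots.card = n := by
    rw [← hsplit.natDegree_eq_card_roots, Matrix.charpoly_natDegree_eq_dim, Fintype.card_fin]
  have hex : ∃ α : Fin n → ℂ, A.charpoly.roots = Multiset.map α Finset.univ.val := by
    obtain ⟨L, hL⟩ := Quot.exists_rep A.charpoly.roots
    have hL' : (L : Multiset ℂ) = A.charpoly.roots := hL
    rw [← hL'] at hcard ⊢
    have hlen : L.length = n := by simpa using hcard
    subst hlen
    exact ⟨L.get, by rw [Fin.univ_val_map, List.ofFn_get]⟩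
  have hα : A.charpoly.roots = Multiset.map (rootsEnum n A.charpoly) Finset.univ.val := by
    rw [rootsEnum, dif_pos hex]
    exact hex.choose_spec
  rw [polyDisc, Matrix.det_aeval_eq_prod_roots]
  generalize rootsEnum n A.charpoly = α at hα
  have hchar : A.charpoly = Lagrange.nodal Finset.univ α := by
    rw [hsplit.eq_prod_roots_of_monic A.charpoly_monic, hα, Multiset.map_map]; rfl
  have hder : ∀ i, eval (α i) (derivative A.charpoly) =
      ∏ j ∈ Finset.univ.erase i, (α i - α j) := by
    intro i
    rw [hchar, Lagrange.eval_nodal_derivative_eval_node_eq (Finset.mem_univ i),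
      Lagrange.eval_nodal]
  rw [hα, Multiset.map_map]
  change _ = (∏ i, eval (α i) (derivative A.charpoly)) ^ 2
  have hsplit2 : ∀ i, (∏ j ∈ Finset.univ.erase i, (α i - α j)) ^ 2 =
      (∏ j ∈ Finset.univ.filter (fun j => i < j), (α i - α j) ^ 2) *
      ∏ j ∈ Finset.univ.filter (fun j => j < i), (α i - α j) ^ 2 := by
    intro i
    rw [← Finset.prod_pow, ← Finset.prod_union]
    · congr 1
      ext j
      simp [lt_or_lt_iff_ne, eq_comm]
    · exact Finset.disjoint_filter.mpr fun j _ h => not_lt_of_gt h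
  have hprod : (∏ i, eval (α i) (derivative A.charpoly)) ^ 2 =
      ∏ i, ((∏ j ∈ Finset.univ.filter (fun j => i < j), (α i - α j) ^ 2) *
        ∏ j ∈ Finset.univ.filter (fun j => j < i), (α i - α j) ^ 2) := by
    rw [← Finset.prod_pow]
    exact Finset.prod_congr rfl fun i _ => by rw [hder i, hsplit2 i]
  rw [hprod, Finset.prod_mul_distrib, pow_two]
  congr 1
  simp_rw [Finset.prod_filter]
  rw [Finset.prod_comm]
  refine Finset.prod_congr rfl fun i _ => Finset.prod_congr rfl fun j _ => ?_
  split_ifs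
  · ring
  · rfl

theorem Matrix.card_eq_of_det_fromBlocks_zero_ne_zero {ι κ : Type*} [Fintype ι] [DecidableEq ι]
    [Fintype κ] [DecidableEq κ] (M : Matrix ι κ ℤ) (N : Matrix κ ι ℤ)
    (h : (fromBlocks 0 M N 0).det ≠ 0) : Fintype.card ι = Fintype.card κ := by
  set A := fromBlocks 0 M N 0 with hA
  set D : Matrix (ι ⊕ κ) (ι ⊕ κ) ℤ := fromBlocks 1 0 0 (-1) with hD
  have hAD : A * D = -(D * A) := by
    simp [hA, hD, Matrix.fromBlocks_multiply, Matrix.fromBlocks_neg]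
  have h1 : (A.adjugate * (A * D)).trace = A.det * D.trace := by
    rw [← Matrix.mul_assoc, Matrix.adjugate_mul, Matrix.smul_mul, Matrix.one_mul,
      Matrix.trace_smul, smul_eq_mul]
  have h2 : (A.adjugate * (A * D)).trace = -(A.det * D.trace) := by
    rw [hAD, Matrix.mul_neg, Matrix.trace_neg, Matrix.trace_mul_comm, Matrix.mul_assoc,
      Matrix.mul_adjugate, Matrix.mul_smul, Matrix.mul_one, Matrix.trace_smul, smul_eq_mul]
  have h3 : D.trace = 0 := by
    have : A.det * D.trace = 0 := by linarith
    exact (mul_eq_zero.mp this).resolve_left h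
  have h4 : D.trace = Fintype.card ι - Fintype.card κ := by
    simp [hD, Matrix.trace, Fintype.sum_sum_type, sub_eq_add_neg]
  rw [h4] at h3
  exact_mod_cast sub_eq_zero.mp h3

theorem Matrix.charpoly_fromBlocks_zero_of_card_eq {ι κ : Type*} [Fintype ι] [DecidableEq ι]
    [Fintype κ] [DecidableEq κ] (M : Matrix ι κ ℤ) (N : Matrix κ ι ℤ)
    (h : Fintype.card ι = Fintype.card κ) :
    (fromBlocks 0 M N 0).charpoly = expand ℤ 2 (M * N).charpoly := by
  have key : charmatrix (fromBlocks 0 M N 0) *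
      fromBlocks (Matrix.scalar ι (X : ℤ[X])) 0 (N.map C) 1 =
      fromBlocks ((charmatrix (M * N)).map (expand ℤ 2)) (-M.map C) 0
        (Matrix.scalar κ (X : ℤ[X])) := by
    rw [Matrix.charmatrix_fromBlocks, Matrix.fromBlocks_multiply]
    congr 1
    · ext i j
      by_cases hij : i = j
      · subst hij
        simp [Matrix.mul_apply, pow_two]
        ring
      · simp [Matrix.mul_apply, hij]
    · simp
    · ext i j
      simp [Matrix.mul_apply, Matrix.diagonal_apply, mul_comm]
    · simp [Matrix.charmatrix_zero]
  have hd := congrArg Matrix.det key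
  rw [Matrix.det_mul, Matrix.det_fromBlocks_zero₁₂, Matrix.det_fromBlocks_zero₂₁] at hd
  have he : ((charmatrix (M * N)).map (expand ℤ 2)).det = expand ℤ 2 (M * N).charpoly :=
    (AlgHom.map_det (expand ℤ 2) _).symm
  rw [he] at hd
  simp only [Matrix.scalar_apply, Matrix.det_diagonal, Finset.prod_const, Finset.card_univ,
    Matrix.det_one, mul_one, h] at hd
  exact mul_right_cancel₀ (pow_ne_zero _ X_ne_zero) hd

theorem Matrix.aeval_fromBlocks_diagonal {ι κ : Type*} [Fintype ι] [DecidableEq ι]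
    [Fintype κ] [DecidableEq κ] (P : Matrix ι ι ℤ) (Q : Matrix κ κ ℤ) (f : ℤ[X]) :
    aeval (fromBlocks P 0 0 Q) f = fromBlocks (aeval P f) 0 0 (aeval Q f) := by
  induction f using Polynomial.induction_on' with
  | add p q hp hq => simp [hp, hq, Matrix.fromBlocks_add]
  | monomial n a =>
    have : fromBlocks P 0 0 Q ^ n = fromBlocks (P ^ n) 0 0 (Q ^ n) := by
      induction n with
      | zero => simp
      | succ n ih => simp [pow_succ, ih, Matrix.fromBlocks_multiply]
    simp only [aeval_monomial, ← Algebra.smul_def, this, Matrix.fromBlocks_smul, smul_zero]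

theorem Matrix.det_aeval_derivative_charpoly_fromBlocks {ι κ : Type*} [Fintype ι] [DecidableEq ι]
    [Fintype κ] [DecidableEq κ] (M : Matrix ι κ ℤ) (N : Matrix κ ι ℤ)
    (h : (fromBlocks 0 M N 0).det ≠ 0) :
    (aeval (fromBlocks 0 M N 0) (derivative (fromBlocks 0 M N 0).charpoly)).det =
      2 ^ Fintype.card (ι ⊕ κ) * (fromBlocks 0 M N 0).det *
        (aeval (M * N) (derivative (M * N).charpoly)).det ^ 2 := by
  have hcard := Matrix.card_eq_of_det_fromBlocks_zero_ne_zero M N h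
  have hNM : (M * N).charpoly = (N * M).charpoly := by
    have := Matrix.charpoly_mul_comm' M N
    rw [hcard] at this
    exact mul_left_cancel₀ (pow_ne_zero _ X_ne_zero) this
  have hsq : fromBlocks 0 M N 0 ^ 2 = fromBlocks (M * N) 0 0 (N * M) := by
    simp [pow_two, Matrix.fromBlocks_multiply]
  rw [Matrix.charpoly_fromBlocks_zero_of_card_eq M N hcard, Polynomial.derivative_expand, map_mul,
    Polynomial.expand_aeval, hsq, Matrix.aeval_fromBlocks_diagonal, Matrix.det_mul,
    Matrix.det_fromBlocks_zero₂₁,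
    ← Matrix.det_aeval_congr_of_charpoly_eq hNM (derivative (M * N).charpoly)]
  have h2 : aeval (fromBlocks 0 M N 0) (((2 : ℕ) : ℤ[X]) * X ^ (2 - 1)) =
      (2 : ℤ) • fromBlocks 0 M N 0 := by
    simp [two_smul, two_mul]
  rw [h2, Matrix.det_smul]
  ring

theorem Matrix.det_aeval_derivative_charpoly_of_bipartite {ι : Type*} [Fintype ι] [DecidableEq ι]
    {A : Matrix ι ι ℤ} (hdet : A.det ≠ 0) (P : ι → Prop) [DecidablePred P]
    (hP : ∀ i j, A i j ≠ 0 → (P i ↔ ¬ P j)) :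
    (aeval A (derivative A.charpoly)).det = 2 ^ Fintype.card ι * A.det *
      (aeval ((A * A).submatrix (Subtype.val : {i // P i} → ι) Subtype.val)
        (derivative ((A * A).submatrix (Subtype.val : {i // P i} → ι) Subtype.val).charpoly)).det
          ^ 2 := by
  set M := A.submatrix (Subtype.val : {i // P i} → ι) (Subtype.val : {i // ¬ P i} → ι) with hM
  set N := A.submatrix (Subtype.val : {i // ¬ P i} → ι) (Subtype.val : {i // P i} → ι) with hN
  have hblock : fromBlocks 0 M N 0 =
      Matrix.reindex (Equiv.sumCompl P).symm (Equiv.sumCompl P).symm A := by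
    have h0 : ∀ i j, (P i ↔ P j) → A i j = 0 := fun i j hij => by
      by_contra hne
      have := hP i j hne
      tauto
    ext (i | i) (j | j)
    · simp [h0 i j (by simp [i.2, j.2])]
    · rfl
    · rfl
    · simp [h0 i j (by simp [i.2, j.2])]
  have hR : (A * A).submatrix (Subtype.val : {i // P i} → ι) Subtype.val = M * N := by
    ext i j
    simp only [Matrix.submatrix_apply, Matrix.mul_apply, hM, hN]
    rw [← Fintype.sum_subtype_add_sum_subtype P]
    convert zero_add _ using 2
    refine Finset.sum_eq_zero fun k _ => ?_
    have : A i k = 0 := by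
      by_contra hne
      exact (hP _ _ hne).mp i.2 k.2
    rw [this, zero_mul]
  have hchar : (fromBlocks 0 M N 0).charpoly = A.charpoly := by
    rw [hblock, Matrix.charpoly_reindex]
  have hdet' : (fromBlocks 0 M N 0).det = A.det := by
    rw [hblock, Matrix.det_reindex_self]
  rw [hR, ← hdet', ← Matrix.det_aeval_congr_of_charpoly_eq hchar, ← hchar,
    Matrix.det_aeval_derivative_charpoly_fromBlocks M N (by rwa [hdet']),
    Fintype.card_congr (Equiv.sumCompl P)]

/-- A sign-valued weight on the edges of a tree is the coboundary of a sign-valued function on the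
vertices. -/
theorem SimpleGraph.IsTree.exists_sign_eq_mul {V : Type*} {G : SimpleGraph V} (hG : G.IsTree)
    (w : V → V → ℤ) (hw : ∀ u v, G.Adj u v → w u v * w u v = 1)
    (hsymm : ∀ u v, w u v = w v u) :
    ∃ s : V → ℤ, (∀ v, s v * s v = 1) ∧ ∀ u v, G.Adj u v → w u v = s u * s v := by
  obtain ⟨r⟩ := hG.connected.nonempty
  choose p hp huniq using fun v => hG.existsUnique_path v r
  let f : ∀ {u v : V}, G.Walk u v → ℤ := fun q => (q.darts.map fun d => w d.fst d.snd).prod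
  have hf : ∀ {u v : V} (q : G.Walk u v), f q * f q = 1 := by
    intro u v q
    induction q with
    | nil => simp [f]
    | cons h q ih =>
      simp only [f, SimpleGraph.Walk.darts_cons, List.map_cons, List.prod_cons] at ih ⊢
      rw [mul_mul_mul_comm, ih, hw _ _ h, one_mul]
  have hcons : ∀ {u v x : V} (h : G.Adj u v) (q : G.Walk v x), f (.cons h q) = w u v * f q := by
    intro u v x h q
    simp [f]
  have hstep : ∀ u v, G.Adj u v → f (p u) = w u v * f (p v) := by
    intro u v h
    by_cases hv : v ∈ (p u).support
    · have h1 : (p u).takeUntil v hv = .cons h .nil :=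
        congrArg Subtype.val ((hG.isAcyclic.subsingleton_path u v).elim
          ⟨_, (hp u).takeUntil hv⟩ ⟨.cons h .nil, by simp [h.ne]⟩)
      have h2 : p u = .cons h (p v) := by
        conv_lhs => rw [← (p u).take_spec hv, h1]
        rw [huniq v _ ((hp u).dropUntil hv)]
        rfl
      rw [h2, hcons]
    · have h2 : p v = .cons h.symm (p u) := (huniq v _ ((hp u).cons hv)).symm
      rw [h2, hcons, hsymm v u, ← mul_assoc, hw u v h, one_mul]
  refine ⟨fun v => f (p v), fun v => hf _, fun u v h => ?_⟩
  change w u v = f (p u) * f (p v)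
  rw [hstep u v h, mul_assoc, hf, mul_one]

/-- The underlying graph of a signed graph with irreducible characteristic polynomial and as many
edges as a tree is a tree. -/
theorem SimpleGraph.isTree_of_irreducible_charpoly {n : ℕ} {B : Matrix (Fin n) (Fin n) ℤ}
    (hB : IsSignedAdjMatrix B) {G : SimpleGraph (Fin n)} (hG : ∀ i j, B i j ≠ 0 ↔ G.Adj i j)
    (hirr : Irreducible (B.map (Int.cast : ℤ → ℚ)).charpoly) {T : SimpleGraph (Fin n)}
    (hT : T.IsTree) {A : Matrix (Fin n) (Fin n) ℤ} (hA : IsSignedAdjMatrix A)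
    (hAT : ∀ i j, A i j ≠ 0 ↔ T.Adj i j) (h : (A * A).trace = (B * B).trace) : G.IsTree := by
  have hedge : ∀ {M : Matrix (Fin n) (Fin n) ℤ} {H : SimpleGraph (Fin n)}, IsSignedAdjMatrix M →
      (∀ i j, M i j ≠ 0 ↔ H.Adj i j) → (M * M).trace = 2 * H.edgeFinset.card := by
    intro M H hM hH
    have h1 := H.sum_degrees_eq_twice_card_edges
    have h2 : (M * M).trace = ∑ v, (H.degree v : ℤ) := by
      refine Finset.sum_congr rfl fun v _ => ?_
      rw [Matrix.diag_apply, Matrix.mul_apply, ← SimpleGraph.card_neighborFinset_eq_degree,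
        SimpleGraph.neighborFinset_eq_filter, Finset.card_filter]
      push_cast
      refine Finset.sum_congr rfl fun j _ => ?_
      rw [hM.1.apply v j]
      by_cases hvj : H.Adj v j
      · have := (hH v j).mpr hvj
        rcases hM.2.2 v j with h | h | h <;> simp_all
      · have : M v j = 0 := by by_contra hne; exact hvj ((hH v j).mp hne)
        simp [this, hvj]
    rw [h2]
    exact_mod_cast h1
  obtain ⟨r⟩ := hT.connected.nonempty
  have hconn : G.Connected := by
    rw [SimpleGraph.connected_iff]
    refine ⟨?_, ⟨r⟩⟩
    suffices hr : ∀ v, G.Reachable r v from fun u v => (hr u).symm.trans (hr v)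
    let W : Submodule ℚ (Fin n → ℚ) :=
      { carrier := {x | ∀ v, ¬ G.Reachable r v → x v = 0}
        add_mem' := fun {a b} ha hb v hv => by simp [ha v hv, hb v hv]
        zero_mem' := fun v _ => rfl
        smul_mem' := fun c x hx v hv => by simp [hx v hv] }
    have hW := Matrix.eq_bot_or_eq_top_of_irreducible_charpoly hirr W (by
      intro x hx v hv
      rw [Matrix.mulVec, dotProduct]
      refine Finset.sum_eq_zero fun j _ => ?_
      by_cases hj : G.Reachable r j
      · have : B v j = 0 := by
          by_contra hne
          exact hv (hj.trans ((hG v j).mp hne).symm.reachable)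
        simp [this]
      · rw [hx j hj, mul_zero])
    have hr1 : (Pi.single r 1 : Fin n → ℚ) ∈ W := by
      intro v hv
      exact Pi.single_eq_of_ne (fun h => hv (by rw [h])) _
    rcases hW with hW | hW
    · rw [hW, Submodule.mem_bot, Pi.single_eq_zero_iff] at hr1
      exact absurd hr1 one_ne_zero
    · intro v
      by_contra hv
      have : (1 : Fin n → ℚ) ∈ W := hW ▸ Submodule.mem_top
      exact one_ne_zero (this v hv)
  refine SimpleGraph.isTree_iff_connected_and_card.mpr ⟨hconn, ?_⟩
  have hTc := (SimpleGraph.isTree_iff_connected_and_card.mp hT).2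
  rw [hedge hA hAT, hedge hB hG] at h
  rw [Nat.card_eq_fintype_card, ← SimpleGraph.edgeFinset_card] at hTc ⊢
  omega

theorem Matrix.exists_aeval_mulVec_eq {F ι : Type*} [Field F] [Fintype ι] [DecidableEq ι]
    {A : Matrix ι ι F} (hA : Irreducible A.charpoly) {e : ι → F} (he : e ≠ 0) (u : ι → F) :
    ∃ f : F[X], aeval A f *ᵥ e = u := by
  let φ : F[X] →ₗ[F] ι → F :=
    { toFun := fun f => aeval A f *ᵥ e
      map_add' := fun f g => by rw [map_add, Matrix.add_mulVec]
      map_smul' := fun c f => by rw [map_smul, Matrix.smul_mulVec, RingHom.id_apply] }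
  rcases Matrix.eq_bot_or_eq_top_of_irreducible_charpoly hA (LinearMap.range φ) (by
    rintro _ ⟨f, rfl⟩
    refine ⟨X * f, ?_⟩
    change aeval A (X * f) *ᵥ e = A *ᵥ (aeval A f *ᵥ e)
    rw [map_mul, aeval_X, Matrix.mulVec_mulVec]) with h | h
  · have : φ 1 = 0 := by rw [LinearMap.range_eq_bot.mp h, LinearMap.zero_apply]
    exact absurd (by simpa [φ] using this) he
  · exact LinearMap.range_eq_top.mp h u

theorem Matrix.injective_mulVec_or_eq_zero_of_commute {F ι : Type*} [Field F] [Fintype ι]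
    [DecidableEq ι] {A X : Matrix ι ι F} (hA : Irreducible A.charpoly) (h : A * X = X * A) :
    (∀ v, X *ᵥ v = 0 → v = 0) ∨ X = 0 := by
  rcases Matrix.eq_bot_or_eq_top_of_irreducible_charpoly hA (LinearMap.ker X.mulVecLin) (by
    intro w hw
    rw [LinearMap.mem_ker, Matrix.mulVecLin_apply] at hw ⊢
    rw [Matrix.mulVec_mulVec, ← h, ← Matrix.mulVec_mulVec, hw, Matrix.mulVec_zero]) with hk | hk
  · left
    intro v hv
    have : v ∈ LinearMap.ker X.mulVecLin := hv
    rwa [hk, Submodule.mem_bot] at this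
  · right
    rw [LinearMap.ker_eq_top] at hk
    exact Matrix.toLin'.map_eq_zero_iff.mp hk

theorem Matrix.exists_eq_aeval_of_commute {F ι : Type*} [Field F] [Fintype ι] [DecidableEq ι]
    {A X : Matrix ι ι F} (hA : Irreducible A.charpoly) (h : A * X = X * A) :
    ∃ f : F[X], X = aeval A f := by
  have hne : Nonempty ι := by
    by_contra hne
    rw [not_nonempty_iff] at hne
    exact hA.not_isUnit (by rw [Matrix.charpoly_isEmpty]; exact isUnit_one)
  have he : (1 : ι → F) ≠ 0 := one_ne_zero
  obtain ⟨f, hf⟩ := Matrix.exists_aeval_mulVec_eq hA he (X *ᵥ 1)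
  refine ⟨f, sub_eq_zero.mp ?_⟩
  refine (Matrix.injective_mulVec_or_eq_zero_of_commute hA ?_).resolve_left fun hinj =>
    he (hinj 1 (by rw [Matrix.sub_mulVec, hf, sub_self]))
  have : A * aeval A f = aeval A f * A := by
    simpa only [map_mul, aeval_X] using congrArg (aeval A) (mul_comm Polynomial.X f)
  rw [Matrix.mul_sub, Matrix.sub_mul, h, this]

theorem Matrix.eq_one_or_eq_neg_one_of_commute {F ι : Type*} [Field F] [Fintype ι] [DecidableEq ι]
    {A X : Matrix ι ι F} (hA : Irreducible A.charpoly) (h : A * X = X * A) (hX : X * X = 1) :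
    X = 1 ∨ X = -1 := by
  have hc : A * (X - 1) = (X - 1) * A := by
    rw [Matrix.mul_sub, Matrix.sub_mul, h, Matrix.mul_one, Matrix.one_mul]
  rcases Matrix.injective_mulVec_or_eq_zero_of_commute hA hc with hi | hz
  · right
    rw [eq_neg_iff_add_eq_zero, ← Matrix.mulVec_injective.eq_iff]
    funext v
    rw [Matrix.zero_mulVec]
    apply hi
    rw [Matrix.mulVec_mulVec]
    have : (X - 1) * (X + 1) = 0 := by
      rw [Matrix.mul_add, Matrix.sub_mul, hX]; simp
    rw [this, Matrix.zero_mulVec]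
  · exact .inl (sub_eq_zero.mp hz)

theorem Matrix.det_add_vecMulVec_of_det_ne_zero {R ι : Type*} [CommRing R] [IsDomain R] [Fintype ι]
    [DecidableEq ι] (M : Matrix ι ι R) (hM : M.det ≠ 0) (u v : ι → R) :
    (M + vecMulVec u v).det = M.det + v ⬝ᵥ M.adjugate *ᵥ u := by
  have h1 : (fromBlocks M (replicateCol Unit (-u)) (replicateRow Unit v) 1).det =
      (M + vecMulVec u v).det := by
    rw [Matrix.det_fromBlocks_one₂₂]
    congr 1
    ext i j
    simp [Matrix.mul_apply, Matrix.vecMulVec_apply]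
  have h2 : fromBlocks 1 0 (-(replicateRow Unit v * M.adjugate)) (M.det • 1) *
      fromBlocks M (replicateCol Unit (-u)) (replicateRow Unit v) 1 =
      fromBlocks M (replicateCol Unit (-u)) 0
        (replicateRow Unit (fun _ : Unit => M.det + v ⬝ᵥ M.adjugate *ᵥ u)) := by
    rw [Matrix.fromBlocks_multiply]
    congr 1
    · simp
    · simp
    · rw [Matrix.neg_mul, Matrix.mul_assoc, Matrix.adjugate_mul]
      simp
    · ext i j
      simp [Matrix.mul_assoc, Matrix.mul_apply, dotProduct, Matrix.mulVec, add_comm]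
  have h3 := congrArg Matrix.det h2
  rw [Matrix.det_mul, h1, Matrix.det_fromBlocks_zero₁₂, Matrix.det_fromBlocks_zero₂₁] at h3
  simp only [Matrix.det_one, one_mul, Matrix.det_unique, Matrix.smul_apply, Matrix.one_apply_eq,
    smul_eq_mul, mul_one, Matrix.replicateRow_apply] at h3
  exact mul_left_cancel₀ hM h3

theorem Matrix.charpoly_compl_comp {ι : Type*} [Fintype ι] [DecidableEq ι] (A : Matrix ι ι ℤ) :
    ((Matrix.of fun _ _ => (1 : ℤ)) - 1 - A).charpoly.comp (-X - 1) =
      (-1) ^ Fintype.card ι *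
        (A.charpoly + 1 ⬝ᵥ (charmatrix A).adjugate *ᵥ (1 : ι → ℤ[X])) := by
  rw [Matrix.charpoly, ← Polynomial.coe_compRingHom_apply, RingHom.map_det, Matrix.charpoly,
    ← Matrix.det_add_vecMulVec_of_det_ne_zero _ A.charpoly_monic.ne_zero, ← Matrix.det_neg]
  congr 1
  ext1 i j
  by_cases hij : i = j
  · subst hij
    simp
    ring
  · simp [hij]
    ring

theorem Matrix.coeff_adjugate_charmatrix {R ι : Type*} [CommRing R] [Nontrivial R] [Fintype ι]
    [DecidableEq ι] (A : Matrix ι ι R) (i j : ι) :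
    ((charmatrix A).adjugate i j).coeff (Fintype.card ι) = 0 := by
  have : Nonempty ι := ⟨i⟩
  have h1 : matPolyEquiv (charmatrix A).adjugate * (X - C A) =
      A.charpoly.map (algebraMap R (Matrix ι ι R)) := by
    rw [← matPolyEquiv_charmatrix, ← map_mul, Matrix.adjugate_mul, matPolyEquiv_smul_one]
    rfl
  have h2 := congrArg Polynomial.degree h1
  have h3 : (A.charpoly.map (algebraMap R (Matrix ι ι R))).degree = Fintype.card ι := by
    rw [A.charpoly_monic.degree_map, Matrix.charpoly_degree_eq_dim]
  rw [(monic_X_sub_C A).degree_mul, h3, degree_X_sub_C] at h2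
  rw [← matPolyEquiv_coeff_apply, Polynomial.coeff_eq_zero_of_degree_lt]
  · rfl
  · rw [← h2]
    revert h2
    cases (matPolyEquiv (charmatrix A).adjugate).degree with
    | bot => exact fun h => (WithBot.bot_ne_coe h).elim
    | coe m => exact fun _ => WithBot.coe_lt_coe.mpr (Nat.lt_succ_self m)

/-- Generalized cospectral integer matrices have the same total walk counts. -/
theorem Matrix.one_dotProduct_pow_mulVec_one_eq {ι : Type*} [Fintype ι] [DecidableEq ι]
    {A B : Matrix ι ι ℤ} (h1 : B.charpoly = A.charpoly)
    (h2 : ((Matrix.of fun _ _ => (1 : ℤ)) - 1 - B).charpoly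
      = ((Matrix.of fun _ _ => (1 : ℤ)) - 1 - A).charpoly) (k : ℕ) :
    (1 : ι → ℤ) ⬝ᵥ (A ^ k) *ᵥ 1 = (1 : ι → ℤ) ⬝ᵥ (B ^ k) *ᵥ 1 := by
  let N : Matrix ι ι ℤ → ℕ → ℤ[X] := fun M k =>
    1 ⬝ᵥ ((M ^ k).map C * (charmatrix M).adjugate) *ᵥ 1
  have hC : ∀ M : Matrix ι ι ℤ, (1 : ι → ℤ[X]) ⬝ᵥ (M.map C) *ᵥ 1 = C ((1 : ι → ℤ) ⬝ᵥ M *ᵥ 1) := by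
    intro M
    simp [dotProduct, Matrix.mulVec]
  have hN0 : N A 0 = N B 0 := by
    have h := congrArg (fun f : ℤ[X] => f.comp (-X - 1)) h2
    simp only [Matrix.charpoly_compl_comp, h1] at h
    have h' := add_left_cancel (mul_left_cancel₀ (by simp) h)
    simpa [N] using h'.symm
  have hsucc : ∀ M k, N M (k + 1) = X * N M k - C ((1 : ι → ℤ) ⬝ᵥ (M ^ k) *ᵥ 1) * M.charpoly := by
    intro M k
    have hadj : M.map C * (charmatrix M).adjugate =
        (X : ℤ[X]) • (charmatrix M).adjugate - M.charpoly • 1 := by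
      have := Matrix.mul_adjugate (charmatrix M)
      rw [charmatrix, Matrix.sub_mul] at this
      rw [Matrix.charpoly, charmatrix, ← this]
      simp [Matrix.smul_eq_diagonal_mul]
    have : (M ^ (k + 1)).map C = (M ^ k).map C * M.map C := by rw [pow_succ, Matrix.map_mul]
    simp only [N]
    rw [this, Matrix.mul_assoc, hadj, Matrix.mul_sub, Matrix.mul_smul, Matrix.mul_smul,
      Matrix.mul_one, Matrix.sub_mulVec, dotProduct_sub, Matrix.smul_mulVec, Matrix.smul_mulVec,
      dotProduct_smul, dotProduct_smul, hC, smul_eq_mul, smul_eq_mul, mul_comm M.charpoly]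
  have hdeg : ∀ M k, (N M k).coeff (Fintype.card ι) = 0 := by
    intro M k
    simp [N, dotProduct, Matrix.mulVec, Matrix.mul_apply, Matrix.coeff_adjugate_charmatrix]
  have hcoeff : ∀ M : Matrix ι ι ℤ, M.charpoly.coeff (Fintype.card ι) = 1 := by
    intro M
    simpa [Matrix.charpoly_natDegree_eq_dim] using M.charpoly_monic.coeff_natDegree
  have hcount : ∀ M k,
      (1 : ι → ℤ) ⬝ᵥ (M ^ k) *ᵥ 1 = (X * N M k).coeff (Fintype.card ι) := by
    intro M k
    have := congrArg (fun f => f.coeff (Fintype.card ι)) (hsucc M k)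
    simp only [hdeg, coeff_sub, coeff_C_mul, hcoeff, mul_one] at this
    exact (sub_eq_zero.mp this.symm).symm
  have hN : N A k = N B k := by
    induction k with
    | zero => exact hN0
    | succ k ih => rw [hsucc, hsucc, hcount, hcount, ih, h1]
  rw [hcount, hcount, hN]

/-- Two symmetric matrices over a field with the same moments at a vector `e`, which is cyclic for
the second one, are conjugate by an orthogonal matrix fixing `e`. -/
theorem Matrix.exists_orthogonal_of_moments_eq {F ι : Type*} [Field F] [Fintype ι] [DecidableEq ι]
    {A B : Matrix ι ι F} (hA : A.IsSymm) (hB : B.IsSymm) {e : ι → F}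
    (hBe : ∀ u, ∃ f : F[X], aeval B f *ᵥ e = u)
    (h : ∀ k, e ⬝ᵥ (A ^ k) *ᵥ e = e ⬝ᵥ (B ^ k) *ᵥ e) :
    ∃ Q : Matrix ι ι F, Qᵀ * Q = 1 ∧ A * Q = Q * B ∧ Qᵀ *ᵥ e = e := by
  have hf : ∀ f : F[X], e ⬝ᵥ (aeval A f) *ᵥ e = e ⬝ᵥ (aeval B f) *ᵥ e := by
    intro f
    induction f using Polynomial.induction_on' with
    | add p q hp hq => simp only [map_add, Matrix.add_mulVec, dotProduct_add, hp, hq]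
    | monomial n a =>
      simp only [aeval_monomial, ← Algebra.smul_def, Matrix.smul_mulVec, dotProduct_smul, h]
  have hmul : ∀ {M : Matrix ι ι F}, M.IsSymm → ∀ f g : F[X],
      (aeval M f *ᵥ e) ⬝ᵥ (aeval M g *ᵥ e) = e ⬝ᵥ (aeval M (f * g)) *ᵥ e := by
    intro M hM f g
    rw [map_mul, ← Matrix.mulVec_mulVec, Matrix.dotProduct_mulVec e, ← Matrix.mulVec_transpose,
      (hM.aeval f).eq]
  choose f hfB using fun j : ι => hBe (Pi.single j 1)
  let Q : Matrix ι ι F := Matrix.of fun i j => (aeval A (f j) *ᵥ e) i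
  have hQQ : Qᵀ * Q = 1 := by
    ext i j
    change (aeval A (f i) *ᵥ e) ⬝ᵥ (aeval A (f j) *ᵥ e) = _
    rw [hmul hA, hf, ← hmul hB, hfB, hfB]
    simp [Matrix.one_apply, Pi.single_apply, eq_comm]
  have hQAQ : Qᵀ * (A * Q) = B := by
    ext i j
    change (aeval A (f i) *ᵥ e) ⬝ᵥ (A *ᵥ (aeval A (f j) *ᵥ e)) = _
    have hX : ∀ M : Matrix ι ι F, M *ᵥ (aeval M (f j) *ᵥ e) = aeval M (X * f j) *ᵥ e := by
      intro M
      rw [map_mul, aeval_X, Matrix.mulVec_mulVec]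
    rw [hX, hmul hA, hf, ← hmul hB, ← hX, hfB, hfB]
    simp
  refine ⟨Q, hQQ, ?_, ?_⟩
  · rw [← hQAQ, ← Matrix.mul_assoc, mul_eq_one_comm.mp hQQ, Matrix.one_mul]
  · ext i
    change (aeval A (f i) *ᵥ e) ⬝ᵥ e = _
    have := hmul hA (f i) 1
    rw [map_one, Matrix.one_mulVec] at this
    rw [this, hf, ← hmul hB, hfB]
    simp

/-- An orthogonal matrix intertwining two matrices that are anti-invariant under sign changes
respects the sign changes, up to a global sign. -/
theorem Matrix.exists_diagonal_mul_eq_mul_diagonal {F ι : Type*} [Field F] [Fintype ι]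
    [DecidableEq ι] {A B Q : Matrix ι ι F} (hA : A.IsSymm) (hirr : Irreducible A.charpoly)
    (hQQ : Qᵀ * Q = 1) (hAQ : A * Q = Q * B) {s t : ι → F} (hs : ∀ i, s i * s i = 1)
    (ht : ∀ i, t i * t i = 1) (hAs : A * diagonal s = -(diagonal s * A))
    (hBt : B * diagonal t = -(diagonal t * B)) :
    diagonal s * Q = Q * diagonal t ∨ diagonal s * Q = -(Q * diagonal t) := by
  have hQQ' : Q * Qᵀ = 1 := mul_eq_one_comm.mp hQQ
  have hss : diagonal s * diagonal s = 1 := by simp [Matrix.diagonal_mul_diagonal, hs]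
  have htt : diagonal t * diagonal t = 1 := by simp [Matrix.diagonal_mul_diagonal, ht]
  have hBQ : B * Qᵀ = Qᵀ * A := by
    calc B * Qᵀ = Qᵀ * Q * B * Qᵀ := by rw [hQQ, Matrix.one_mul]
      _ = Qᵀ * (A * Q) * Qᵀ := by rw [hAQ]; simp only [Matrix.mul_assoc]
      _ = Qᵀ * A := by rw [Matrix.mul_assoc, Matrix.mul_assoc, hQQ', Matrix.mul_one]
  set Y := diagonal s * Q * diagonal t * Qᵀ with hY
  have hcomm : A * Y = Y * A := by
    calc A * Y = (A * diagonal s) * Q * diagonal t * Qᵀ := by rw [hY]; simp only [Matrix.mul_assoc]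
      _ = -(diagonal s * (A * Q) * diagonal t * Qᵀ) := by
        rw [hAs]; simp only [Matrix.mul_assoc, Matrix.neg_mul]
      _ = -(diagonal s * Q * (B * diagonal t) * Qᵀ) := by
        rw [hAQ]; simp only [Matrix.mul_assoc]
      _ = diagonal s * Q * diagonal t * (B * Qᵀ) := by
        rw [hBt]; simp only [Matrix.mul_assoc, Matrix.neg_mul, Matrix.mul_neg, neg_neg]
      _ = Y * A := by rw [hBQ, hY]; simp only [Matrix.mul_assoc]
  have hYsymm : Yᵀ = Y := by
    obtain ⟨f, hf⟩ := Matrix.exists_eq_aeval_of_commute hirr hcomm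
    rw [hf]
    exact hA.aeval f
  have hYY : Y * Y = 1 := by
    calc Y * Y = Y * Yᵀ := by rw [hYsymm]
      _ = diagonal s * (Q * (diagonal t * (Qᵀ * Q) * diagonal t) * Qᵀ) * diagonal s := by
        rw [hY]
        simp only [Matrix.transpose_mul, Matrix.transpose_transpose, Matrix.diagonal_transpose,
          Matrix.mul_assoc]
      _ = 1 := by
        rw [hQQ, Matrix.mul_one, htt, Matrix.mul_one, hQQ', Matrix.mul_one, hss]
  have hkey : diagonal s * Y * Q * diagonal t = Q := by
    calc diagonal s * Y * Q * diagonal t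
        = (diagonal s * diagonal s) * Q * (diagonal t * (Qᵀ * Q) * diagonal t) := by
          rw [hY]; simp only [Matrix.mul_assoc]
      _ = Q := by rw [hss, hQQ, Matrix.mul_one, htt, Matrix.mul_one, Matrix.one_mul]
  have hst : diagonal s * Q = Y * Q * diagonal t := by
    conv_lhs => rw [← hkey]
    rw [← Matrix.mul_assoc, ← Matrix.mul_assoc, ← Matrix.mul_assoc, hss, Matrix.one_mul]
  rcases Matrix.eq_one_or_eq_neg_one_of_commute hirr hcomm hYY with h | h
  · left; rw [hst, h, Matrix.one_mul]
  · right; rw [hst, h]; simp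

theorem Matrix.charpoly_sq_eq_of_charpoly_eq {ι κ : Type*} [Fintype ι] [DecidableEq ι]
    [Fintype κ] [DecidableEq κ] {A : Matrix ι ι ℤ} {B : Matrix κ κ ℤ}
    (h : A.charpoly = B.charpoly) : (A * A).charpoly = (B * B).charpoly := by
  refine Polynomial.funext fun m => ?_
  have := Matrix.det_aeval_congr_of_charpoly_eq h (C m - X * X)
  simpa [Matrix.eval_charpoly, Matrix.scalar_apply, Algebra.algebraMap_eq_smul_one,
    Matrix.smul_one_eq_diagonal] using this

theorem Matrix.trace_eq_of_charpoly_eq {R ι : Type*} [CommRing R] [Fintype ι] [DecidableEq ι]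
    {A B : Matrix ι ι R} (h : A.charpoly = B.charpoly) : A.trace = B.trace := by
  cases isEmpty_or_nonempty ι
  · simp [Matrix.trace]
  · rw [Matrix.trace_eq_neg_charpoly_coeff, Matrix.trace_eq_neg_charpoly_coeff, h]

/-- The part of a rational orthogonal matrix, intertwining two integer matrices, that lies over a
colour class of a bipartition is integral, provided a discriminant is suitably square-free. -/
theorem Matrix.exists_intCast_eq_of_colour_class {ι : Type*} [Fintype ι] [DecidableEq ι]
    {A B : Matrix ι ι ℤ} {Q : Matrix ι ι ℚ} (hA : A.IsSymm)
    (hAQ : A.map (Int.cast : ℤ → ℚ) * Q = Q * B.map (Int.cast : ℤ → ℚ)) (hQQ : Qᵀ * Q = 1)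
    (P P' : ι → Prop) [DecidablePred P] [DecidablePred P']
    (hPQ : ∀ i j, Q i j ≠ 0 → (P i ↔ P' j))
    (hdisc : ∀ p : ℕ, p.Prime → ¬ (p : ℤ) ^ 2 ∣
      (aeval ((A * A).submatrix (Subtype.val : {i // P i} → ι) Subtype.val)
        (derivative ((A * A).submatrix (Subtype.val : {i // P i} → ι) Subtype.val).charpoly)).det)
    (i j : ι) (hi : P i) : ∃ z : ℤ, Q i j = z := by
  have h0 : ∀ {i j}, ¬ (P i ↔ P' j) → Q i j = 0 := fun {i j} h => by
    by_contra hne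
    exact h (hPQ i j hne)
  by_cases hj : P' j
  swap
  · exact ⟨0, by rw [h0 (by tauto), Int.cast_zero]⟩
  have hAAQ : (A * A).map (Int.cast : ℤ → ℚ) * Q = Q * (B * B).map (Int.cast : ℤ → ℚ) := by
    rw [Matrix.map_intCast_mul, Matrix.map_intCast_mul, Matrix.mul_assoc, hAQ, ← Matrix.mul_assoc,
      hAQ, Matrix.mul_assoc]
  have hAA : ((A * A).submatrix (Subtype.val : {i // P i} → ι) Subtype.val).IsSymm := by
    refine Matrix.IsSymm.submatrix ?_ _
    rw [Matrix.IsSymm, Matrix.transpose_mul, hA.eq]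
  obtain ⟨Z, hZ⟩ := Matrix.exists_int_eq_map_of_not_sq_dvd hAA
    (B := (B * B).submatrix (Subtype.val : {j // P' j} → ι) Subtype.val)
    (Q := Q.submatrix (Subtype.val : {i // P i} → ι) (Subtype.val : {j // P' j} → ι)) (by
      ext a b
      have := congrFun (congrFun hAAQ a) b
      rw [Matrix.mul_apply, Matrix.mul_apply, ← Fintype.sum_subtype_add_sum_subtype P,
        ← Fintype.sum_subtype_add_sum_subtype P' fun k => Q a k * _,
        Finset.sum_eq_zero (s := (Finset.univ : Finset {i // ¬ P i})) fun k _ => by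
          rw [h0 (fun h => k.2 (h.mpr b.2)), mul_zero],
        Finset.sum_eq_zero (s := (Finset.univ : Finset {i // ¬ P' i})) fun k _ => by
          rw [h0 (fun h => k.2 (h.mp a.2)), zero_mul], add_zero, add_zero] at this
      exact this) (by
      ext a b
      have := congrFun (congrFun hQQ a) b
      rw [Matrix.mul_apply, ← Fintype.sum_subtype_add_sum_subtype P,
        Finset.sum_eq_zero (s := (Finset.univ : Finset {i // ¬ P i})) fun k _ => by
          rw [h0 (i := (k : ι)) (j := b) (fun h => k.2 (h.mpr b.2)), mul_zero], add_zero] at this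
      refine Eq.trans this ?_
      simp [Matrix.one_apply, Subtype.ext_iff]) hdisc
  exact ⟨Z ⟨i, hi⟩ ⟨j, hj⟩, congrFun (congrFun hZ ⟨i, hi⟩) ⟨j, hj⟩⟩

/-- An integer orthogonal matrix with column sums one is a permutation matrix. -/
theorem Matrix.exists_eq_permMatrix {ι : Type*} [Fintype ι] [DecidableEq ι] {Z : Matrix ι ι ℤ}
    (hZZ : Zᵀ * Z = 1) (hZ : Zᵀ *ᵥ 1 = 1) : ∃ σ : Equiv.Perm ι, Z = σ.permMatrix ℤ := by
  have hsum : ∀ j, ∑ i, Z i j = 1 := fun j => by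
    simpa [Matrix.mulVec, dotProduct] using congrFun hZ j
  have hsq : ∀ j, ∑ i, Z i j * Z i j = 1 := fun j => by
    simpa [Matrix.mul_apply] using congrFun (congrFun hZZ j) j
  have h01 : ∀ i j, Z i j = 0 ∨ Z i j = 1 := by
    intro i j
    have h0 : ∑ i, (Z i j * Z i j - Z i j) = 0 := by
      rw [Finset.sum_sub_distrib, hsum, hsq, sub_self]
    have := (Finset.sum_eq_zero_iff_of_nonneg fun i _ =>
      sub_nonneg.mpr (by simpa [pow_two] using Int.le_self_sq (Z i j))).mp h0 i (Finset.mem_univ i)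
    have h2 : Z i j * (Z i j - 1) = 0 := by rw [mul_sub, mul_one]; exact this
    exact (mul_eq_zero.mp h2).imp_right sub_eq_zero.mp
  have hex : ∀ j, ∃ i, Z i j = 1 := by
    intro j
    by_contra! hne
    have := hsum j
    rw [Finset.sum_eq_zero fun i _ => (h01 i j).resolve_right (hne i)] at this
    exact zero_ne_one this
  choose τ hτ using hex
  have hZτ : ∀ i j, Z i j = if i = τ j then 1 else 0 := by
    intro i j
    split_ifs with h
    · rw [h, hτ]
    · have h1 := hsum j
      rw [← Finset.add_sum_erase _ _ (Finset.mem_univ (τ j)), hτ, add_eq_left,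
        Finset.sum_eq_zero_iff_of_nonneg fun i _ => by rcases h01 i j with h | h <;> simp [h]] at h1
      exact h1 i (Finset.mem_erase.mpr ⟨h, Finset.mem_univ i⟩)
  have hinj : Function.Injective τ := by
    intro j k hjk
    by_contra hne
    have := congrFun (congrFun hZZ j) k
    simp [Matrix.mul_apply, hZτ, hjk, hne] at this
  refine ⟨(Equiv.ofBijective τ (Finite.injective_iff_bijective.mp hinj)).symm, ?_⟩
  ext i j
  rw [hZτ, Equiv.Perm.permMatrix, PEquiv.toMatrix_apply]
  refine if_congr ?_ rfl rfl
  simp [Equiv.symm_apply_eq]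

theorem SimpleGraph.map_adjMatrix_intCast {R V : Type*} [Ring R] (T : SimpleGraph V)
    [DecidableRel T.Adj] : (T.adjMatrix ℤ).map (Int.castRingHom R) = T.adjMatrix R := by
  ext i j
  rw [Matrix.map_apply, SimpleGraph.adjMatrix_apply, SimpleGraph.adjMatrix_apply]
  split_ifs <;> simp

/-- Signings of a tree do not change the characteristic polynomial. -/
theorem IsSignedAdjMatrix.charpoly_eq_of_isTree {n : ℕ} {T : SimpleGraph (Fin n)}
    [DecidableRel T.Adj] (hT : T.IsTree) {A : Matrix (Fin n) (Fin n) ℤ} (hA : IsSignedAdjMatrix A)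
    (hAT : ∀ i j, A i j ≠ 0 ↔ T.Adj i j) : A.charpoly = (T.adjMatrix ℤ).charpoly := by
  obtain ⟨s, hs, hAs⟩ := hT.exists_sign_eq_mul A (fun u v huv => by
    have := (hAT u v).mpr huv
    rcases hA.2.2 u v with h | h | h <;> simp_all) (fun u v => hA.1.apply v u)
  have hAD : A = diagonal s * T.adjMatrix ℤ * diagonal s := by
    ext i j
    rw [Matrix.mul_diagonal, Matrix.diagonal_mul, SimpleGraph.adjMatrix_apply]
    split_ifs with h
    · rw [mul_one, hAs i j h]
    · rw [mul_zero, zero_mul]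
      by_contra hne
      exact h ((hAT i j).mp hne)
  have hss : diagonal s * diagonal s = 1 := by simp [Matrix.diagonal_mul_diagonal, hs]
  rw [hAD, Matrix.charpoly_mul_comm, ← Matrix.mul_assoc, hss, Matrix.one_mul]

/-- A tree has a proper colouring by signs. -/
theorem SimpleGraph.IsTree.exists_sign_mul_eq_neg_one {V : Type*} {G : SimpleGraph V}
    (hG : G.IsTree) : ∃ s : V → ℤ, (∀ v, s v * s v = 1) ∧ ∀ u v, G.Adj u v → s u * s v = -1 := by
  obtain ⟨s, hs, h⟩ := hG.exists_sign_eq_mul (fun _ _ => -1) (fun _ _ _ => rfl) fun _ _ => rfl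
  exact ⟨s, hs, fun u v huv => (h u v huv).symm⟩

theorem Matrix.map_intCast_mul_diagonal_eq_neg {ι : Type*} [Fintype ι] [DecidableEq ι]
    {A : Matrix ι ι ℤ} {s : ι → ℤ} (hs : ∀ i, s i * s i = 1)
    (hAs : ∀ i j, A i j ≠ 0 → s i * s j = -1) :
    A.map (Int.cast : ℤ → ℚ) * diagonal (fun i => (s i : ℚ)) =
      -(diagonal (fun i => (s i : ℚ)) * A.map (Int.cast : ℤ → ℚ)) := by
  ext i j
  rw [Matrix.neg_apply, Matrix.mul_diagonal, Matrix.diagonal_mul, Matrix.map_apply]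
  by_cases h : A i j = 0
  · simp [h]
  · have : s j = -s i := by
      linear_combination s i * hAs i j h - s j * hs i
    rw [this]
    push_cast
    ring

theorem Int.not_sq_dvd_of_sq_mul_pow_eq {d a δ : ℤ} (hd : Squarefree d)
    (h : (d ^ 2) ^ 2 = (a * δ ^ 2) ^ 2) (p : ℕ) (hp : p.Prime) : ¬ (p : ℤ) ^ 2 ∣ δ := by
  intro hpδ
  have h1 : ((p : ℤ) ^ 2) ^ 4 ∣ d ^ 4 := by
    have : d ^ 4 = a ^ 2 * δ ^ 4 := by linear_combination h
    rw [this]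
    exact (pow_dvd_pow_of_dvd hpδ 4).mul_left _
  have h2 : (p : ℤ) ^ 2 ∣ d := (Int.pow_dvd_pow_iff (by norm_num)).mp h1
  rw [pow_two] at h2
  exact (Nat.prime_iff_prime_int.mp hp).not_isUnit (hd _ h2)

theorem Matrix.det_ne_zero_of_irreducible_charpoly {ι : Type*} [Fintype ι] [DecidableEq ι]
    {A : Matrix ι ι ℤ} (hirr : Irreducible (A.map (Int.cast : ℤ → ℚ)).charpoly)
    (heven : Even (aeval A (derivative A.charpoly)).det) : A.det ≠ 0 := by
  intro hdet
  have hdetQ : (A.map (Int.cast : ℤ → ℚ)).det = 0 := by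
    have := RingHom.map_det (Int.castRingHom ℚ) A
    rw [hdet, map_zero] at this
    exact this.symm
  obtain ⟨v, hv, hAv⟩ := Matrix.exists_mulVec_eq_zero_iff.mpr hdetQ
  have hA0 : A = 0 := by
    apply Matrix.map_injective (Int.cast_injective (α := ℚ))
    beta_reduce
    rw [(Matrix.injective_mulVec_or_eq_zero_of_commute hirr rfl).resolve_left fun h => hv (h v hAv)]
    simp
  subst hA0
  have h1 : Fintype.card ι = 1 := by
    by_contra hne
    refine not_irreducible_pow hne (x := (X : ℚ[X])) ?_
    simpa [Matrix.charpoly_zero] using hirr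
  have h2 : (0 : Matrix ι ι ℤ).charpoly = X := by simp [Matrix.charpoly_zero, h1]
  rw [h2] at heven
  simp at heven

theorem stmt1 {n : ℕ} (T : SimpleGraph (Fin n)) [DecidableRel T.Adj]
    (hT : T.IsTree)
    (hirr : Irreducible (T.adjMatrix ℚ).charpoly)
    (d : ℤ) (hd0 : 0 < d) (hdodd : Odd d) (hdsf : Squarefree d)
    (hdisc : polyDisc n (T.adjMatrix ℂ).charpoly = 2 ^ n * (d : ℂ) ^ 2)
    (A : Matrix (Fin n) (Fin n) ℤ) (hA : IsSignedAdjMatrix A)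
    (hAT : ∀ i j, A i j ≠ 0 ↔ T.Adj i j)
    (B : Matrix (Fin n) (Fin n) ℤ) (hB : IsSignedAdjMatrix B)
    (h1 : B.charpoly = A.charpoly)
    (h2 : ((Matrix.of fun _ _ => (1 : ℤ)) - 1 - B).charpoly
        = ((Matrix.of fun _ _ => (1 : ℤ)) - 1 - A).charpoly) :
    ∃ σ : Equiv.Perm (Fin n), (σ.permMatrix ℤ)ᵀ * A * σ.permMatrix ℤ = B := by
  have hAc : A.charpoly = (T.adjMatrix ℤ).charpoly := hA.charpoly_eq_of_isTree hT hAT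
  have hmap : ∀ (R : Type) [CommRing R],
      (A.map (Int.castRingHom R)).charpoly = (T.adjMatrix R).charpoly := by
    intro R _
    rw [Matrix.charpoly_map, hAc, ← Matrix.charpoly_map, T.map_adjMatrix_intCast]
  have hirrA : Irreducible (A.map (Int.cast : ℤ → ℚ)).charpoly := by
    change Irreducible (A.map (Int.castRingHom ℚ)).charpoly
    rwa [hmap]
  have hirrB : Irreducible (B.map (Int.cast : ℤ → ℚ)).charpoly := by
    change Irreducible (B.map (Int.castRingHom ℚ)).charpoly
    rwa [Matrix.charpoly_map, h1, ← Matrix.charpoly_map]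
  -- the underlying graph of `B` is a tree
  let G : SimpleGraph (Fin n) :=
    { Adj := fun i j => B i j ≠ 0
      symm := ⟨fun i j h => by rwa [hB.1.apply]⟩
      loopless := ⟨fun i h => h (hB.2.1 i)⟩ }
  have hG : G.IsTree := SimpleGraph.isTree_of_irreducible_charpoly hB (fun _ _ => Iff.rfl) hirrB
    hT hA hAT (Matrix.trace_eq_of_charpoly_eq (Matrix.charpoly_sq_eq_of_charpoly_eq h1.symm))
  obtain ⟨s, hs, hsA⟩ := hT.exists_sign_mul_eq_neg_one
  obtain ⟨t, ht, htB⟩ := hG.exists_sign_mul_eq_neg_one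
  have hsA' : ∀ i j, A i j ≠ 0 → s i * s j = -1 := fun i j h => hsA i j ((hAT i j).mp h)
  -- the rational orthogonal matrix
  have hwalk := Matrix.one_dotProduct_pow_mulVec_one_eq h1 h2
  obtain ⟨r⟩ := hT.connected.nonempty
  have hone : (1 : Fin n → ℚ) ≠ 0 := fun h => one_ne_zero (congrFun h r)
  obtain ⟨Q, hQQ, hAQ, hQe⟩ := Matrix.exists_orthogonal_of_moments_eq (e := (1 : Fin n → ℚ))
    (hA.1.map (Int.cast : ℤ → ℚ)) (hB.1.map (Int.cast : ℤ → ℚ))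
    (Matrix.exists_aeval_mulVec_eq hirrB hone) (fun k => by
      have hcast : ∀ M : Matrix (Fin n) (Fin n) ℤ,
          (1 : Fin n → ℚ) ⬝ᵥ (M.map (Int.cast : ℤ → ℚ) ^ k) *ᵥ 1 =
            (((1 : Fin n → ℤ) ⬝ᵥ (M ^ k) *ᵥ 1 : ℤ) : ℚ) := by
        intro M
        have : M.map (Int.cast : ℤ → ℚ) ^ k = (M ^ k).map (Int.cast : ℤ → ℚ) :=
          (map_pow (Int.castRingHom ℚ).mapMatrix M k).symm
        rw [this]
        simp [dotProduct, Matrix.mulVec]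
      rw [hcast, hcast, hwalk k])
  obtain ⟨t', htQ⟩ : ∃ t' : Fin n → ℤ, ∀ i j, Q i j ≠ 0 → s i = t' j := by
    have hentry : ∀ (t' : Fin n → ℤ), diagonal (fun i => (s i : ℚ)) * Q =
        Q * diagonal (fun i => (t' i : ℚ)) → ∀ i j, Q i j ≠ 0 → s i = t' j := by
      intro t' h i j hij
      have := congrFun (congrFun h i) j
      rw [Matrix.mul_diagonal, Matrix.diagonal_mul, mul_comm] at this
      exact_mod_cast mul_left_cancel₀ hij this
    rcases Matrix.exists_diagonal_mul_eq_mul_diagonal (hA.1.map (Int.cast : ℤ → ℚ)) hirrA hQQ hAQ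
      (s := fun i => (s i : ℚ)) (t := fun i => (t i : ℚ)) (fun i => by exact_mod_cast hs i)
      (fun i => by exact_mod_cast ht i) (Matrix.map_intCast_mul_diagonal_eq_neg hs hsA')
      (Matrix.map_intCast_mul_diagonal_eq_neg ht htB) with h | h
    · exact ⟨t, hentry t h⟩
    · refine ⟨fun i => -t i, hentry _ ?_⟩
      rw [h, ← Matrix.mul_neg, Matrix.diagonal_neg]
      push_cast
      rfl
  -- the discriminant
  have hD : (aeval A (derivative A.charpoly)).det ^ 2 = (2 ^ n * d ^ 2) ^ 2 := by
    apply Int.cast_injective (α := ℂ)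
    have hdet := RingHom.map_det (Int.castRingHom ℂ) (aeval A (derivative A.charpoly))
    rw [RingHom.mapMatrix_apply, Matrix.map_aeval, ← derivative_map, ← Matrix.charpoly_map] at hdet
    have := polyDisc_sq_eq (A.map (Int.castRingHom ℂ))
    rw [← hdet, hmap, hdisc] at this
    rw [Int.cast_pow]
    exact this.symm.trans (by push_cast; rfl)
  have heven : Even (aeval A (derivative A.charpoly)).det := by
    have hn : n ≠ 0 := by rintro rfl; exact r.elim0
    have : Even ((aeval A (derivative A.charpoly)).det ^ 2) := by
      rw [hD]
      exact (((Int.even_pow' hn).mpr even_two).mul_right _).pow_of_ne_zero two_ne_zero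
    exact (Int.even_pow' two_ne_zero).mp this
  have hdetA := Matrix.det_ne_zero_of_irreducible_charpoly hirrA heven
  have hclass : ∀ (P P' : Fin n → Prop), (∀ i j, A i j ≠ 0 → (P i ↔ ¬ P j)) →
      (∀ i j, Q i j ≠ 0 → (P i ↔ P' j)) → ∀ i j, P i → ∃ z : ℤ, Q i j = z := by
    intro P P' hP hPQ
    refine Matrix.exists_intCast_eq_of_colour_class hA.1 hAQ hQQ P P' hPQ ?_
    have hdet := Matrix.det_aeval_derivative_charpoly_of_bipartite hdetA P hP
    rw [hdet, Fintype.card_fin] at hD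
    refine Int.not_sq_dvd_of_sq_mul_pow_eq hdsf (a := A.det) ?_
    refine mul_left_cancel₀ (pow_ne_zero 2 (pow_ne_zero n (two_ne_zero (α := ℤ)))) ?_
    rw [← mul_pow, ← mul_pow, ← hD, mul_assoc]
  have hQint : ∀ i j, ∃ z : ℤ, Q i j = z := by
    have hP : ∀ i j, A i j ≠ 0 → (s i = 1 ↔ ¬ s j = 1) := by
      intro i j h
      have := hsA' i j h
      rcases mul_self_eq_one_iff.mp (hs i) with h | h <;>
        rcases mul_self_eq_one_iff.mp (hs j) with h' | h' <;> simp [h, h'] at this ⊢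
    intro i j
    by_cases hi : s i = 1
    · exact hclass (fun i => s i = 1) (fun j => t' j = 1) hP
        (fun i j h => by rw [htQ i j h]) i j hi
    · exact hclass (fun i => ¬ s i = 1) (fun j => ¬ t' j = 1)
        (fun i j h => not_congr (hP i j h)) (fun i j h => by rw [htQ i j h]) i j hi
  -- integrality makes it a permutation matrix
  choose z hz using hQint
  obtain rfl : Q = (Matrix.of z).map (Int.cast : ℤ → ℚ) := by ext i j; exact hz i j
  have hinj := Matrix.map_injective (m := Fin n) (n := Fin n) (Int.cast_injective (α := ℚ))
  have hZZ : (Matrix.of z)ᵀ * Matrix.of z = 1 := by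
    apply hinj
    beta_reduce
    rw [Matrix.map_intCast_mul, Matrix.transpose_map, hQQ]
    simp
  have hAZ : A * Matrix.of z = Matrix.of z * B := by
    apply hinj
    beta_reduce
    rw [Matrix.map_intCast_mul, Matrix.map_intCast_mul, hAQ]
  have hZe : (Matrix.of z)ᵀ *ᵥ 1 = 1 := by
    ext i
    have := congrFun hQe i
    apply Int.cast_injective (α := ℚ)
    simpa [Matrix.mulVec, dotProduct] using this
  obtain ⟨σ, hσ⟩ := Matrix.exists_eq_permMatrix hZZ hZe
  refine ⟨σ, ?_⟩
  rw [← hσ, Matrix.mul_assoc, hAZ, ← Matrix.mul_assoc, hZZ, Matrix.one_mul]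
end
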